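/- For any canonical module ω_R of R, the endomorphism ring Hom_R(H^{n−1}_I(ω_R), H^{n−1}_I(ω_R)) is isomorphic as an R-algebra to the formal power series ring S = 𝕜[[x_1,…,x_m, a_1,…,a_{n−1}]] (with R-algebra structure via φ); in particular this endomorphism ring is commutative and Noetherian. -/

import Mathlib

open CategoryTheory Opposite MvPowerSeries

set_option synthInstance.maxHeartbeats 1000000
set_option maxHeartbeats 1000000

noncomputable section

/-- The grade of an ideal: the maximal length of a regular sequence contained in it. -/
def idealGrade {A : Type} [CommRing A] (J : Ideal A) : ℕ∞ :=
  sSup {c : ℕ∞ | ∃ rs : List A, (∀ r ∈ rs, r ∈ J) ∧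
    RingTheory.Sequence.IsRegular A rs ∧ (rs.length : ℕ∞) = c}

/-- The height of an ideal: the infimum of heights of primes containing it. -/
def idealHeight {A : Type} [CommRing A] (J : Ideal A) : ℕ∞ :=
  sInf {h : ℕ∞ | ∃ p : PrimeSpectrum A, J ≤ p.asIdeal ∧ Order.height p = h}

/-- A canonical module of a `d`-dimensional local ring `A`: a finitely generated module `ω`
with `Ext_A^i(𝕜, ω) = 0` for `i ≠ d` and `Ext_A^d(𝕜, ω)` a one-dimensional `𝕜`-vector space
(equivalently, isomorphic to `𝕜` as an `A`-module), where `𝕜` is the residue field. -/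
def IsCanonicalModule (A : Type) [CommRing A] [IsLocalRing A] (d : ℕ)
    (ω : ModuleCat A) : Prop :=
  Module.Finite A ω ∧
  (∀ i : ℕ, i ≠ d → Subsingleton
    (((Ext A (ModuleCat A) i).obj
      (op (ModuleCat.of A (IsLocalRing.ResidueField A)))).obj ω)) ∧
  Nonempty ((((Ext A (ModuleCat A) d).obj
      (op (ModuleCat.of A (IsLocalRing.ResidueField A)))).obj ω)
    ≃ₗ[A] IsLocalRing.ResidueField A)

variable (𝕜 : Type) [Field 𝕜] (m n : ℕ)

/-- The formal power series ring `P` in the entries of an `m × n` matrix of variables. -/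
abbrev DetP := MvPowerSeries (Fin m × Fin n) 𝕜

/-- The ideal of `P` generated by the `2 × 2` minors of the matrix of variables. -/
def detI2 : Ideal (DetP 𝕜 m n) :=
  Ideal.span {f | ∃ (i k : Fin m) (j l : Fin n), i < k ∧ j < l ∧
    f = X (i, j) * X (k, l) - X (i, l) * X (k, j)}

/-- The complete determinantal ring `R = P/I₂(X)`. -/
abbrev DetR := DetP 𝕜 m n ⧸ detI2 𝕜 m n

/-- The residue class in `R` of the variable `x_{ij}`. -/
def detx (i : Fin m) (j : Fin n) : DetR 𝕜 m n :=
  Ideal.Quotient.mk (detI2 𝕜 m n) (X (i, j))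

/-- The ideal `I` of `R` generated by the entries of the first `n - 1` columns. -/
def detJ : Ideal (DetR 𝕜 m n) :=
  Ideal.span {x | ∃ (i : Fin m) (j : Fin n), (j : ℕ) < n - 1 ∧ x = detx 𝕜 m n i j}

/-- The formal power series ring `S = 𝕜[[x_1, …, x_m, a_1, …, a_{n-1}]]`. -/
abbrev DetS := MvPowerSeries (Fin m ⊕ Fin (n - 1)) 𝕜

/-- The ideal `𝔞 = (a_1, …, a_{n-1})S`. -/
def detA : Ideal (DetS 𝕜 m n) :=
  Ideal.span {f | ∃ j : Fin (n - 1), f = X (Sum.inr j)}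

/-- The property pinning down the local `𝕜`-algebra homomorphism `φ : R → S`:
`x_{ij} ↦ a_j·x_i` for `1 ≤ j ≤ n-1` and `x_{in} ↦ x_i` (in `0`-based indexing, the last
column is `j = n-1`).  Any `𝕜`-algebra homomorphism `R → S` with these values on the
variables automatically maps the maximal ideal into the maximal ideal, hence is continuous
and is uniquely determined by these values; so this predicate characterizes `φ`. -/
def IsDetPhi (φ : DetR 𝕜 m n →ₐ[𝕜] DetS 𝕜 m n) : Prop :=
  ∀ (i : Fin m) (j : Fin n),
    φ (detx 𝕜 m n i j) =
      if h : (j : ℕ) < n - 1 then X (Sum.inr (⟨j, h⟩ : Fin (n - 1))) * X (Sum.inl i)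
      else X (Sum.inl i)

section ExtComparison

open Abelian

variable {R : Type} [CommRing R]

/-- The class in cohomology of a cocycle of a cochain complex of modules. -/
def cocycleClass (K : CochainComplex (ModuleCat R) ℕ) (n : ℕ) :
    LinearMap.ker (K.d n (n + 1)).hom →ₗ[R] K.homology n :=
  (K.liftCycles (ModuleCat.ofHom (LinearMap.ker (K.d n (n + 1)).hom).subtype) (n + 1)
    (by simp) (by ext x; exact x.2) ≫ K.homologyπ n).hom

lemma cocycleClass_surjective (K : CochainComplex (ModuleCat R) ℕ) (n : ℕ) :
    Function.Surjective (cocycleClass K n) := by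
  intro y
  obtain ⟨z, rfl⟩ := (ModuleCat.epi_iff_surjective (K.homologyπ n)).1 inferInstance y
  have hz : (K.iCycles n).hom z ∈ LinearMap.ker (K.d n (n + 1)).hom := by
    have := congrArg (fun f => f.hom z) (K.iCycles_d n (n + 1))
    exact this
  refine ⟨⟨_, hz⟩, ?_⟩
  simp only [cocycleClass, ModuleCat.hom_comp, LinearMap.comp_apply]
  congr 1
  apply (ModuleCat.mono_iff_injective (K.iCycles n)).1 inferInstance
  have := congrArg (fun f => f.hom ⟨_, hz⟩)
    (K.liftCycles_i (ModuleCat.ofHom (LinearMap.ker (K.d n (n + 1)).hom).subtype) (n + 1)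
    (by simp) (by ext x; exact x.2))
  exact this

lemma cocycleClass_eq_zero_iff (K : CochainComplex (ModuleCat R) ℕ) (p n : ℕ) (hp : p + 1 = n)
    (z : LinearMap.ker (K.d n (n + 1)).hom) :
    cocycleClass K n z = 0 ↔ ∃ g, (K.d p n).hom g = z := by
  have hi : ∀ w : LinearMap.ker (K.d n (n + 1)).hom, (K.iCycles n).hom
      ((K.liftCycles (ModuleCat.ofHom (LinearMap.ker (K.d n (n + 1)).hom).subtype) (n + 1)
    (by simp) (by ext x; exact x.2)).hom w) = w := fun w => by
    have := congrArg (fun f => f.hom w)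
      (K.liftCycles_i (ModuleCat.ofHom (LinearMap.ker (K.d n (n + 1)).hom).subtype) (n + 1)
      (by simp) (by ext x; exact x.2))
    exact this
  have hex : (ShortComplex.mk (K.toCycles p n) (K.homologyπ n) (by simp)).Exact :=
    ShortComplex.exact_of_g_is_cokernel _ (K.homologyIsCokernel p n (by simp [← hp]))
  rw [ShortComplex.moduleCat_exact_iff] at hex
  simp only [cocycleClass, ModuleCat.hom_comp, LinearMap.comp_apply]
  constructor
  · intro h
    obtain ⟨g, hg⟩ := hex _ h
    refine ⟨g, ?_⟩
    rw [← hi z]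
    erw [← hg]
    have := congrArg (fun f => f.hom g) (K.toCycles_i p n)
    exact this.symm
  · rintro ⟨g, hg⟩
    have h2 : (K.liftCycles (ModuleCat.ofHom (LinearMap.ker (K.d n (n + 1)).hom).subtype) (n + 1)
        (by simp) (by ext x; exact x.2)).hom z = (K.toCycles p n).hom g := by
      apply (ModuleCat.mono_iff_injective (K.iCycles n)).1 inferInstance
      refine (hi z).trans ?_
      rw [← hg]
      have := congrArg (fun f => f.hom g) (K.toCycles_i p n)
      exact this.symm
    rw [h2]
    have := congrArg (fun f => f.hom g) (K.toCycles_comp_homologyπ p n)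
    exact this

lemma homologyMap_cocycleClass {K L : CochainComplex (ModuleCat R) ℕ} (φ : K ⟶ L) (n : ℕ)
    (z : LinearMap.ker (K.d n (n + 1)).hom)
    (w : LinearMap.ker (L.d n (n + 1)).hom) (h : (φ.f n).hom z = w) :
    (HomologicalComplex.homologyMap φ n).hom (cocycleClass K n z) = cocycleClass L n w := by
  simp only [cocycleClass, ModuleCat.hom_comp, LinearMap.comp_apply]
  have := congrArg (fun f => f.hom ((K.liftCycles (ModuleCat.ofHom
    (LinearMap.ker (K.d n (n + 1)).hom).subtype) (n + 1)
    (by simp) (by ext x; exact x.2)).hom z)) (HomologicalComplex.homologyπ_naturality φ n)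
  refine this.trans ?_
  simp only [ModuleCat.hom_comp, LinearMap.comp_apply]
  congr 1
  apply (ModuleCat.mono_iff_injective (L.iCycles n)).1 inferInstance
  have e1 := congrArg (fun f => f.hom ((K.liftCycles (ModuleCat.ofHom
    (LinearMap.ker (K.d n (n + 1)).hom).subtype) (n + 1)
    (by simp) (by ext x; exact x.2)).hom z)) (HomologicalComplex.cyclesMap_i φ n)
  have e2 := congrArg (fun f => f.hom z)
      (K.liftCycles_i (ModuleCat.ofHom (LinearMap.ker (K.d n (n + 1)).hom).subtype) (n + 1)
      (by simp) (by ext x; exact x.2))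
  have e3 := congrArg (fun f => f.hom w)
      (L.liftCycles_i (ModuleCat.ofHom (LinearMap.ker (L.d n (n + 1)).hom).subtype) (n + 1)
      (by simp) (by ext x; exact x.2))
  simp only [ModuleCat.hom_comp, LinearMap.comp_apply, ModuleCat.hom_ofHom,
    Submodule.subtype_apply] at e1 e2 e3
  refine e1.trans ?_
  erw [e2, e3]
  exact h

end ExtComparison

section ExtNaturality

open Abelian

variable {R : Type} [CommRing R]

/-- The map of cochain complexes of homomorphisms induced by a map of chain complexes. -/
def linearYonedaMap {K L : ChainComplex (ModuleCat.{0} R) ℕ} (φ : K ⟶ L) (Y : ModuleCat.{0} R) :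
    L.linearYonedaObj R Y ⟶ K.linearYonedaObj R Y where
  f i := ModuleCat.ofHom
    { toFun := fun g => φ.f i ≫ g
      map_add' := fun _ _ => Preadditive.comp_add _ _ _ _ _ _
      map_smul' := fun _ _ => Linear.comp_smul _ _ _ _ _ _ }
  comm' i j _ := by
    ext g
    exact (φ.comm_assoc j i g).symm

lemma comp_inv_eq_of_square {C : Type*} [Category C] {A A' B B' D D' : C} {a : A ⟶ A'}
    {p : A' ⟶ B'} {q : A ⟶ B} {g : B ⟶ B'} {u : D ≅ B} {u' : D' ≅ B'} {h : D ⟶ D'}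
    (e₁ : a ≫ p = q ≫ g) (e₂ : u.hom ≫ g = h ≫ u'.hom) :
    a ≫ p ≫ u'.inv = (q ≫ u.inv) ≫ h := by
  rw [reassoc_of% e₁, Category.assoc, (Iso.eq_inv_comp u).2 (by
    rw [← Category.assoc, e₂, Category.assoc, Iso.hom_inv_id, Category.comp_id] :
    u.hom ≫ g ≫ u'.inv = h)]

lemma isoExt_hom_naturality {X X' : ModuleCat.{0} R} (f : X' ⟶ X) (P : ProjectiveResolution X')
    (Q : ProjectiveResolution X) (φ : ProjectiveResolution.Hom P Q f) (Y : ModuleCat.{0} R)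
    (n : ℕ) :
    ((Ext R (ModuleCat.{0} R) n).map f.op).app Y ≫ (P.isoExt n Y).hom =
      (Q.isoExt n Y).hom ≫
        HomologicalComplex.homologyMap (linearYonedaMap φ.hom Y) n := by
  have h1 := P.isoLeftDerivedObj_inv_naturality f Q φ.hom (by simpa using φ.hom_f_zero_comp_π_f_zero)
    (((linearYoneda R (ModuleCat.{0} R)).obj Y).rightOp) n
  have h2 := HomologicalComplex.homologyOp_hom_naturality (linearYonedaMap φ.hom Y) n
  have h1' := congrArg Quiver.Hom.unop h1
  have h2' := congrArg Quiver.Hom.unop h2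
  have e1 : ((Ext R (ModuleCat.{0} R) n).map f.op).app Y ≫
      (P.isoLeftDerivedObj ((linearYoneda R (ModuleCat.{0} R)).obj Y).rightOp n).inv.unop =
      (Q.isoLeftDerivedObj ((linearYoneda R (ModuleCat.{0} R)).obj Y).rightOp n).inv.unop ≫
      ((((linearYoneda R (ModuleCat.{0} R)).obj Y).rightOp.mapHomologicalComplex _ ⋙
        HomologicalComplex.homologyFunctor _ _ n).map φ.hom).unop := h1'
  have e2 : (HomologicalComplex.homologyUnop
      ((((linearYoneda R (ModuleCat.{0} R)).obj Y).rightOp.mapHomologicalComplex _).obj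
        Q.complex) n).hom ≫
      ((((linearYoneda R (ModuleCat.{0} R)).obj Y).rightOp.mapHomologicalComplex _ ⋙
        HomologicalComplex.homologyFunctor _ _ n).map φ.hom).unop =
      HomologicalComplex.homologyMap (linearYonedaMap φ.hom Y) n ≫
      (HomologicalComplex.homologyUnop
      ((((linearYoneda R (ModuleCat.{0} R)).obj Y).rightOp.mapHomologicalComplex _).obj
        P.complex) n).hom := h2'
  exact comp_inv_eq_of_square e1 e2

end ExtNaturality

section ExtEquiv

open Abelian

variable {R : Type} [CommRing R]

lemma extMk_smul {X Y : ModuleCat.{0} R} (P : ProjectiveResolution X) {n : ℕ} (r : R)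
    (f : P.complex.X n ⟶ Y) (m : ℕ) (hm : n + 1 = m) (hf : P.complex.d m n ≫ f = 0) :
    P.extMk (r • f) m hm (by simp [hf]) = r • P.extMk f m hm hf := by
  have := P.extMk_comp_mk₀ f m hm hf (r • 𝟙 Y)
  simp only [Linear.comp_smul, Category.comp_id] at this
  rw [← this, Ext.mk₀_smul, Ext.comp_smul, Ext.comp_mk₀_id]

/-- The class in `Ext` of a cocycle of homomorphisms out of a projective resolution. -/
def extMkLinear {X : ModuleCat.{0} R} (P : ProjectiveResolution X) (Y : ModuleCat.{0} R) (n : ℕ) :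
    LinearMap.ker ((P.complex.linearYonedaObj R Y).d n (n + 1)).hom →ₗ[R]
      CategoryTheory.Abelian.Ext X Y n where
  toFun z := P.extMk (show P.complex.X n ⟶ Y from z.1) (n + 1) rfl z.2
  map_add' _ _ := (P.add_extMk _ _ _ _ _ _).symm
  map_smul' r _ := extMk_smul P r _ _ _ _

lemma extMkLinear_surjective {X : ModuleCat.{0} R} (P : ProjectiveResolution X)
    (Y : ModuleCat.{0} R) (n : ℕ) : Function.Surjective (extMkLinear P Y n) := by
  intro e
  obtain ⟨f, hf, rfl⟩ := P.extMk_surjective e (n + 1) rfl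
  exact ⟨⟨f, hf⟩, rfl⟩

lemma extMkLinear_eq_zero_iff {X : ModuleCat.{0} R} (P : ProjectiveResolution X)
    (Y : ModuleCat.{0} R) (p n : ℕ) (hp : p + 1 = n)
    (z : LinearMap.ker ((P.complex.linearYonedaObj R Y).d n (n + 1)).hom) :
    extMkLinear P Y n z = 0 ↔ ∃ g, ((P.complex.linearYonedaObj R Y).d p n).hom g = z :=
  P.extMk_eq_zero_iff _ (n + 1) rfl z.2 p hp

/-- Two surjective linear maps with the same kernel have isomorphic targets. -/
def equivOfSurjectiveOfKerEq {A B C : Type} [AddCommGroup A] [AddCommGroup B] [AddCommGroup C]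
    [Module R A] [Module R B] [Module R C] (f : A →ₗ[R] B) (g : A →ₗ[R] C)
    (hf : Function.Surjective f) (hg : Function.Surjective g)
    (h : LinearMap.ker f = LinearMap.ker g) : B ≃ₗ[R] C :=
  (f.quotKerEquivOfSurjective hf).symm ≪≫ₗ Submodule.quotEquivOfEq _ _ h ≪≫ₗ
    g.quotKerEquivOfSurjective hg

lemma equivOfSurjectiveOfKerEq_apply {A B C : Type} [AddCommGroup A] [AddCommGroup B]
    [AddCommGroup C] [Module R A] [Module R B] [Module R C] (f : A →ₗ[R] B) (g : A →ₗ[R] C)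
    (hf : Function.Surjective f) (hg : Function.Surjective g)
    (h : LinearMap.ker f = LinearMap.ker g) (a : A) :
    equivOfSurjectiveOfKerEq f g hf hg h (f a) = g a := by
  have : (f.quotKerEquivOfSurjective hf).symm (f a) = Submodule.Quotient.mk a := by
    rw [LinearEquiv.symm_apply_eq]; rfl
  simp only [equivOfSurjectiveOfKerEq, LinearEquiv.trans_apply, this]
  rfl

/-- Cohomology of homomorphisms out of a projective resolution computes `Ext`. -/
def homologyExtEquiv {X : ModuleCat.{0} R} (P : ProjectiveResolution X)
    (Y : ModuleCat.{0} R) (p n : ℕ) (hp : p + 1 = n) :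
    (P.complex.linearYonedaObj R Y).homology n ≃ₗ[R] CategoryTheory.Abelian.Ext X Y n :=
  equivOfSurjectiveOfKerEq (cocycleClass _ n) (extMkLinear P Y n) (cocycleClass_surjective _ n)
    (extMkLinear_surjective P Y n) (by
      ext z
      rw [LinearMap.mem_ker, LinearMap.mem_ker, cocycleClass_eq_zero_iff _ p n hp,
        extMkLinear_eq_zero_iff P Y p n hp])

lemma homologyExtEquiv_naturality {X X' : ModuleCat.{0} R} {f : X' ⟶ X}
    (P : ProjectiveResolution X') (Q : ProjectiveResolution X) (φ : ProjectiveResolution.Hom P Q f)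
    (Y : ModuleCat.{0} R) (p n : ℕ) (hp : p + 1 = n)
    (y : (Q.complex.linearYonedaObj R Y).homology n) :
    homologyExtEquiv P Y p n hp
        ((HomologicalComplex.homologyMap (linearYonedaMap φ.hom Y) n).hom y) =
      (Ext.mk₀ f).comp (homologyExtEquiv Q Y p n hp y) (zero_add n) := by
  obtain ⟨z, rfl⟩ := cocycleClass_surjective _ _ y
  have hw : ((linearYonedaMap φ.hom Y).f n).hom z.1 ∈
      LinearMap.ker ((P.complex.linearYonedaObj R Y).d n (n + 1)).hom := by
    have h := congrArg (fun g => g.hom z.1) ((linearYonedaMap φ.hom Y).comm n (n + 1))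
    have hz := z.2
    rw [LinearMap.mem_ker] at hz ⊢
    refine h.trans ?_
    simp only [ModuleCat.hom_comp, LinearMap.comp_apply]
    erw [hz, map_zero]
  rw [homologyMap_cocycleClass (linearYonedaMap φ.hom Y) n z ⟨_, hw⟩ rfl]
  simp only [homologyExtEquiv, equivOfSurjectiveOfKerEq_apply]
  exact (Q.mk₀_comp_extMk (show Q.complex.X n ⟶ Y from z.1) (n + 1) rfl z.2 φ).symm

/-- The two definitions of `Ext` agree in positive degrees. -/
def extEquivAbelianExt (X Y : ModuleCat.{0} R) (p n : ℕ) (hp : p + 1 = n) :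
    ((_root_.Ext R (ModuleCat.{0} R) n).obj (op X)).obj Y ≃ₗ[R]
      CategoryTheory.Abelian.Ext X Y n :=
  ((projectiveResolution X).isoExt n Y).toLinearEquiv ≪≫ₗ
    homologyExtEquiv (projectiveResolution X) Y p n hp

lemma extEquivAbelianExt_apply (X Y : ModuleCat.{0} R) (p n : ℕ) (hp : p + 1 = n)
    (y : ((_root_.Ext R (ModuleCat.{0} R) n).obj (op X)).obj Y) :
    extEquivAbelianExt X Y p n hp y = homologyExtEquiv (projectiveResolution X) Y p n hp
      (((projectiveResolution X).isoExt n Y).hom.hom y) := rfl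

lemma extEquivAbelianExt_naturality {X X' : ModuleCat.{0} R} (f : X' ⟶ X)
    (Y : ModuleCat.{0} R) (p n : ℕ) (hp : p + 1 = n)
    (y : ((_root_.Ext R (ModuleCat.{0} R) n).obj (op X)).obj Y) :
    extEquivAbelianExt X' Y p n hp ((((_root_.Ext R (ModuleCat.{0} R) n).map f.op).app Y).hom y) =
      (Ext.mk₀ f).comp (extEquivAbelianExt X Y p n hp y) (zero_add n) := by
  let φ : ProjectiveResolution.Hom (projectiveResolution X') (projectiveResolution X) f :=
    ⟨ProjectiveResolution.lift f _ _, ProjectiveResolution.lift_commutes_zero _ _ _⟩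
  have h := congrArg (fun g => g.hom y) (isoExt_hom_naturality f _ _ φ Y n)
  have h' : ((projectiveResolution X').isoExt n Y).hom.hom
      ((((_root_.Ext R (ModuleCat.{0} R) n).map f.op).app Y).hom y) =
      (HomologicalComplex.homologyMap (linearYonedaMap φ.hom Y) n).hom
        (((projectiveResolution X).isoExt n Y).hom.hom y) := h
  rw [extEquivAbelianExt_apply, extEquivAbelianExt_apply, h', homologyExtEquiv_naturality]

end ExtEquiv

section ExtZero

open Abelian

variable {R : Type} [CommRing R]

lemma cocycleClass_zero_injective (K : CochainComplex (ModuleCat R) ℕ) :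
    Function.Injective (cocycleClass K 0) := by
  intro z w h
  have h1 := (ModuleCat.mono_iff_injective (K.homologyπ 0)).1
    (by have := K.isIso_homologyπ _ 0 rfl (K.shape _ _ (by simp)); infer_instance) h
  have hi : ∀ w : LinearMap.ker (K.d 0 (0 + 1)).hom, (K.iCycles 0).hom
      ((K.liftCycles (ModuleCat.ofHom (LinearMap.ker (K.d 0 (0 + 1)).hom).subtype) (0 + 1)
    (by simp) (by ext x; exact x.2)).hom w) = w := fun w => by
    have := congrArg (fun f => f.hom w)
      (K.liftCycles_i (ModuleCat.ofHom (LinearMap.ker (K.d 0 (0 + 1)).hom).subtype) (0 + 1)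
      (by simp) (by ext x; exact x.2))
    exact this
  exact Subtype.ext (by rw [← hi z, ← hi w]; exact congrArg _ h1)

lemma subsingleton_abelianExt (X Y : ModuleCat.{0} R) (n : ℕ)
    (h : Subsingleton (((_root_.Ext R (ModuleCat.{0} R) n).obj (op X)).obj Y)) :
    Subsingleton (CategoryTheory.Abelian.Ext X Y n) := by
  cases n with
  | succ p => exact (extEquivAbelianExt X Y p _ rfl).symm.toEquiv.subsingleton
  | zero =>
    have h1 : Subsingleton (((projectiveResolution X).complex.linearYonedaObj R Y).homology 0) :=
      ((projectiveResolution X).isoExt 0 Y).toLinearEquiv.symm.toEquiv.subsingleton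
    refine subsingleton_of_forall_eq 0 fun e => ?_
    obtain ⟨z, rfl⟩ := extMkLinear_surjective (projectiveResolution X) Y 0 e
    rw [cocycleClass_zero_injective _ (Subsingleton.elim (cocycleClass _ 0 z)
      (cocycleClass _ 0 0)), map_zero]

end ExtZero

section ExtMod

open Abelian

variable {R : Type} [CommRing R] (ω : ModuleCat.{0} R)
  {M N K : Type} [AddCommGroup M] [Module R M] [AddCommGroup N] [Module R N]
  [AddCommGroup K] [Module R K]

/-- `Ext` groups out of an unbundled module. -/
abbrev ExtMod (M : Type) [AddCommGroup M] [Module R M] (i : ℕ) : Type :=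
  CategoryTheory.Abelian.Ext (ModuleCat.of R M) ω i

/-- The contravariant functoriality of `Ext`. -/
def extMap (f : M →ₗ[R] N) (i : ℕ) : ExtMod ω N i →ₗ[R] ExtMod ω M i where
  toFun x := (Ext.mk₀ (ModuleCat.ofHom f)).comp x (zero_add i)
  map_add' _ _ := Ext.comp_add _ _ _ _
  map_smul' _ _ := Ext.comp_smul _ _ _ _

lemma extMap_id (i : ℕ) : extMap ω (LinearMap.id : M →ₗ[R] M) i = LinearMap.id := by
  ext x
  exact Ext.mk₀_id_comp x

lemma extMap_comp (f : M →ₗ[R] N) (g : N →ₗ[R] K) (i : ℕ) :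
    extMap ω (g ∘ₗ f) i = extMap ω f i ∘ₗ extMap ω g i := by
  ext x
  change (Ext.mk₀ (ModuleCat.ofHom f ≫ ModuleCat.ofHom g)).comp x (zero_add i) = _
  rw [← Ext.mk₀_comp_mk₀_assoc]
  rfl

lemma extMap_comp_apply (f : M →ₗ[R] N) (g : N →ₗ[R] K) (i : ℕ) (x : ExtMod ω K i) :
    extMap ω f i (extMap ω g i x) = extMap ω (g ∘ₗ f) i x := by
  rw [extMap_comp]; rfl

lemma extMap_add (f g : M →ₗ[R] N) (i : ℕ) :
    extMap ω (f + g) i = extMap ω f i + extMap ω g i := by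
  ext x
  change (Ext.mk₀ (ModuleCat.ofHom f + ModuleCat.ofHom g)).comp x (zero_add i) = _
  rw [Ext.mk₀_add, Ext.add_comp]
  rfl

lemma extMap_smul (r : R) (f : M →ₗ[R] N) (i : ℕ) :
    extMap ω (r • f) i = r • extMap ω f i := by
  ext x
  change (Ext.mk₀ (r • ModuleCat.ofHom f)).comp x (zero_add i) = _
  rw [Ext.mk₀_smul, Ext.smul_comp]
  rfl

lemma extMap_zero (i : ℕ) : extMap ω (0 : M →ₗ[R] N) i = 0 := by
  simpa using extMap_smul ω 0 (0 : M →ₗ[R] N) i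

lemma extMap_sum {ι : Type*} (s : Finset ι) (f : ι → M →ₗ[R] N) (i : ℕ) :
    extMap ω (∑ j ∈ s, f j) i = ∑ j ∈ s, extMap ω (f j) i := by
  classical
  induction s using Finset.induction_on with
  | empty => simpa using extMap_zero ω i
  | insert a s ha ih => rw [Finset.sum_insert ha, Finset.sum_insert ha, extMap_add, ih]

lemma extMap_smul_id (r : R) (i : ℕ) (x : ExtMod ω M i) :
    extMap ω (r • LinearMap.id : M →ₗ[R] M) i x = r • x := by
  rw [extMap_smul, extMap_id]; rfl

/-- A linear equivalence induces an equivalence of `Ext` groups. -/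
def extCongr (e : M ≃ₗ[R] N) (i : ℕ) : ExtMod ω N i ≃ₗ[R] ExtMod ω M i :=
  LinearEquiv.ofLinearMap (extMap ω e.toLinearMap i) (extMap ω e.symm.toLinearMap i)
    (by rw [← extMap_comp]; simp [extMap_id]) (by rw [← extMap_comp]; simp [extMap_id])

instance [IsNoetherianRing R] [Module.Finite R M] [Module.Finite R ω] (i : ℕ) :
    Module.Finite R (ExtMod ω M i) :=
  ModuleCat.finite_ext R (ModuleCat.of R M) ω i

variable {f : M →ₗ[R] N} {g : N →ₗ[R] K} (hf : Function.Injective f) (hfg : Function.Exact f g)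
  (hg : Function.Surjective g)

include hf hfg hg

lemma extMap_exact (i : ℕ) : Function.Exact (extMap ω g i) (extMap ω f i) := by
  have hS := ModuleCat.shortComplex_shortExact
    (ShortComplex.mk (ModuleCat.ofHom f) (ModuleCat.ofHom g)
      (by ext x; exact hfg.apply_apply_eq_zero x)) hfg hf hg
  intro x
  constructor
  · exact Ext.contravariant_sequence_exact₂ hS ω x
  · rintro ⟨y, rfl⟩
    rw [extMap_comp_apply, hfg.linearMap_comp_eq_zero, extMap_zero]
    rfl

lemma exists_extMap_connecting (i : ℕ) :
    ∃ δ : ExtMod ω M i →ₗ[R] ExtMod ω K (i + 1),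
      Function.Exact (extMap ω f i) δ ∧ Function.Exact δ (extMap ω g (i + 1)) := by
  have hS := ModuleCat.shortComplex_shortExact
    (ShortComplex.mk (ModuleCat.ofHom f) (ModuleCat.ofHom g)
      (by ext x; exact hfg.apply_apply_eq_zero x)) hfg hf hg
  refine ⟨{ toFun := fun x => hS.extClass.comp x (add_comm 1 i)
            map_add' := fun _ _ => Ext.comp_add _ _ _ _
            map_smul' := fun _ _ => Ext.comp_smul _ _ _ _ }, fun x => ⟨?_, ?_⟩, fun x => ⟨?_, ?_⟩⟩
  · exact Ext.contravariant_sequence_exact₁ hS ω x (add_comm 1 i)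
  · rintro ⟨y, rfl⟩
    exact hS.extClass_comp_assoc y (h := add_comm 1 i)
  · intro h
    exact Ext.contravariant_sequence_exact₃ hS ω x h (add_comm 1 i)
  · rintro ⟨y, rfl⟩
    exact hS.comp_extClass_assoc y (add_comm 1 i)

omit hf hfg in
lemma extMap_zero_injective : Function.Injective (extMap ω g 0) := by
  have : Epi (ModuleCat.ofHom g) := (ModuleCat.epi_iff_surjective _).2 hg
  exact Ext.precomp_mk₀_injective_of_epi ω (ModuleCat.ofHom g)

lemma extMap_injective_of_subsingleton (i : ℕ) (h : ∀ j, j + 1 = i → Subsingleton (ExtMod ω M j)) :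
    Function.Injective (extMap ω g i) := by
  cases i with
  | zero => exact extMap_zero_injective ω hg
  | succ j =>
    have := h j rfl
    obtain ⟨δ, -, h2⟩ := exists_extMap_connecting ω hf hfg hg j
    rw [← LinearMap.ker_eq_bot, LinearMap.ker_eq_bot']
    intro x hx
    obtain ⟨y, rfl⟩ := (h2 x).1 hx
    rw [Subsingleton.elim y 0, map_zero]

lemma extMap_surjective_of_subsingleton (i : ℕ) (h : Subsingleton (ExtMod ω K (i + 1))) :
    Function.Surjective (extMap ω f i) := by
  obtain ⟨δ, h1, -⟩ := exists_extMap_connecting ω hf hfg hg i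
  exact fun x => (h1 x).1 (Subsingleton.elim _ _)

lemma subsingleton_extMod_of_exact (i : ℕ) (h₁ : Subsingleton (ExtMod ω M i))
    (h₂ : Subsingleton (ExtMod ω K i)) : Subsingleton (ExtMod ω N i) := by
  refine subsingleton_of_forall_eq 0 fun x => ?_
  obtain ⟨y, rfl⟩ := (extMap_exact ω hf hfg hg i x).1 (Subsingleton.elim _ _)
  rw [Subsingleton.elim y 0, map_zero]

end ExtMod

section Canonical

variable {R : Type} [CommRing R] [IsLocalRing R] [IsNoetherianRing R] (ω : ModuleCat.{0} R)
  [Module.Finite R ω]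
  {M M' : Type} [AddCommGroup M] [Module R M] [AddCommGroup M'] [Module R M']

omit [IsLocalRing R] [IsNoetherianRing R] [Module.Finite R ω] in
lemma smul_extMod_eq_zero (r : R) (h : ∀ y : M, r • y = 0) (i : ℕ) (z : ExtMod ω M i) :
    r • z = 0 := by
  rw [← extMap_smul_id, show (r • LinearMap.id : M →ₗ[R] M) = 0 from LinearMap.ext h, extMap_zero]
  rfl

omit [IsNoetherianRing R] in
lemma subsingleton_of_smul_surjective [Module.Finite R M] (x : R)
    (hx : x ∈ IsLocalRing.maximalIdeal R) (h : Function.Surjective (fun y : M => x • y)) :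
    Subsingleton M := by
  have : (⊤ : Submodule R M) = ⊥ := by
    refine Submodule.eq_bot_of_le_smul_of_le_jacobson_bot (IsLocalRing.maximalIdeal R) _
      Module.Finite.fg_top ?_ (IsLocalRing.maximalIdeal_le_jacobson _)
    intro y _
    obtain ⟨z, rfl⟩ := h y
    exact Submodule.smul_mem_smul hx trivial
  exact (Submodule.subsingleton_iff R).1 (subsingleton_of_bot_eq_top this.symm)

/-- A module which is isomorphic to its only nonvanishing `Ext` into `ω`. -/
structure IsExtSelfDual (M : Type) [AddCommGroup M] [Module R M] (e : ℕ) : Prop where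
  subsingleton : ∀ i, i ≠ e → Subsingleton (ExtMod ω M i)
  equiv : Nonempty (ExtMod ω M e ≃ₗ[R] M)

lemma IsExtSelfDual.of_smul_exact [Module.Finite R M] {e : ℕ} (h : IsExtSelfDual ω M' (e + 1))
    (x : R) (hx : x ∈ IsLocalRing.maximalIdeal R)
    (hinj : Function.Injective (fun y : M => x • y)) (π : M →ₗ[R] M')
    (hπ : Function.Surjective π) (hker : ∀ y, π y = 0 ↔ ∃ z, x • z = y) (g : M)
    (hg : Submodule.span R {g} = ⊤) : IsExtSelfDual ω M e := by
  have hexact : Function.Exact (x • LinearMap.id : M →ₗ[R] M) π := hker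
  have hinj' : Function.Injective (x • LinearMap.id : M →ₗ[R] M) := hinj
  have hvan : ∀ i, i ≠ e → Subsingleton (ExtMod ω M i) := fun i hi =>
    subsingleton_of_smul_surjective x hx fun y => by
      obtain ⟨z, hz⟩ := extMap_surjective_of_subsingleton ω hinj' hexact hπ i
        (h.subsingleton _ (by simpa using hi)) y
      exact ⟨z, (extMap_smul_id ω x i z).symm.trans hz⟩
  refine ⟨hvan, ?_⟩
  obtain ⟨eM⟩ := h.equiv
  obtain ⟨δ, h1, h2⟩ := exists_extMap_connecting ω hinj' hexact hπ e
  have hNinj : ∀ z : ExtMod ω M e, x • z = 0 → z = 0 := fun z hz => by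
    rw [← extMap_smul_id] at hz
    obtain ⟨y, rfl⟩ := (extMap_exact ω hinj' hexact hπ e z).1 hz
    have := h.subsingleton e (by simp)
    rw [Subsingleton.elim y 0, map_zero]
  let θ : ExtMod ω M e →ₗ[R] M' := eM.toLinearMap ∘ₗ δ
  have hθ : Function.Surjective θ := eM.surjective.comp fun y => by
    have := hvan (e + 1) (by simp)
    exact (h2 y).1 (Subsingleton.elim _ _)
  have hθker : ∀ z, θ z = 0 → ∃ w, x • w = z := fun z hz => by
    obtain ⟨w, hw⟩ := (h1 z).1 (by simpa [θ] using hz)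
    exact ⟨w, by rw [← extMap_smul_id]; exact hw⟩
  have hgen : ∀ y : M, ∃ r : R, r • g = y := fun y =>
    Submodule.mem_span_singleton.1 (hg ▸ Submodule.mem_top)
  obtain ⟨z, hz⟩ := hθ (π g)
  have hspan : Submodule.span R {z} = ⊤ := by
    refine top_le_iff.1 (Submodule.le_of_le_smul_of_le_jacobson_bot
      (I := IsLocalRing.maximalIdeal R) Module.Finite.fg_top
      (IsLocalRing.maximalIdeal_le_jacobson _) ?_)
    intro y _
    obtain ⟨y', hy'⟩ := hπ (θ y)
    obtain ⟨r, rfl⟩ := hgen y'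
    obtain ⟨w, hw⟩ := hθker (y - r • z) (by
      rw [map_sub, map_smul, hz, ← hy', map_smul, sub_self])
    rw [← sub_add_cancel y (r • z), ← hw, add_comm]
    exact Submodule.add_mem_sup (Submodule.smul_mem _ _ (Submodule.mem_span_singleton_self z))
      (Submodule.smul_mem_smul hx trivial)
  let t : R →ₗ[R] M := LinearMap.toSpanSingleton R M g
  have ht : Function.Surjective t := hgen
  let ψ : M →ₗ[R] ExtMod ω M e :=
    (Submodule.liftQ (LinearMap.ker t) (LinearMap.toSpanSingleton R _ z) (by
      intro r hr
      refine smul_extMod_eq_zero ω r (fun y => ?_) e z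
      obtain ⟨s, rfl⟩ := hgen y
      rw [smul_comm, show r • g = 0 from hr, smul_zero])) ∘ₗ
      (t.quotKerEquivOfSurjective ht).symm.toLinearMap
  have hψ : ∀ r : R, ψ (r • g) = r • z := fun r => by
    have : (t.quotKerEquivOfSurjective ht).symm (r • g) = Submodule.Quotient.mk r := by
      rw [LinearEquiv.symm_apply_eq]; rfl
    simp only [ψ, LinearMap.comp_apply, LinearEquiv.coe_coe, this]
    rfl
  have hψsurj : Function.Surjective ψ := fun y => by
    obtain ⟨r, rfl⟩ := Submodule.mem_span_singleton.1 (hspan ▸ Submodule.mem_top : y ∈ _)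
    exact ⟨r • g, hψ r⟩
  have hcomp : ∀ y, θ (ψ y) = π y := fun y => by
    obtain ⟨r, rfl⟩ := hgen y
    rw [hψ, map_smul, map_smul, hz]
  have hψker : LinearMap.ker ψ = ⊥ := by
    refine Submodule.eq_bot_of_le_smul_of_le_jacobson_bot (IsLocalRing.maximalIdeal R) _
      (IsNoetherian.noetherian _) ?_ (IsLocalRing.maximalIdeal_le_jacobson _)
    intro k hk
    have hk' : ψ k = 0 := hk
    obtain ⟨y, rfl⟩ := (hker k).1 (by rw [← hcomp, hk', map_zero])
    refine Submodule.smul_mem_smul hx (hNinj _ ?_)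
    rw [← map_smul]
    exact hk
  exact ⟨(LinearEquiv.ofBijective ψ ⟨LinearMap.ker_eq_bot.1 hψker, hψsurj⟩).symm⟩

omit [Module.Finite R ω] in
lemma subsingleton_extMod_of_maximalIdeal_pow_smul [Module.Finite R M] (d i : ℕ) (hi : i ≠ d)
    (h : IsExtSelfDual ω (IsLocalRing.ResidueField R) d) (t : ℕ)
    (hM : ∀ r ∈ IsLocalRing.maximalIdeal R ^ t, ∀ y : M, r • y = 0) :
    Subsingleton (ExtMod ω M i) := by
  revert hM
  refine IsNoetherianRing.induction_on_isQuotientEquivQuotientPrime (A := R) (M := M)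
    inferInstance (motive := fun N _ _ _ =>
      (∀ r ∈ IsLocalRing.maximalIdeal R ^ t, ∀ y : N, r • y = 0) →
        Subsingleton (ExtMod ω N i)) ?_ ?_ ?_
  · intro N _ _ _ _ _
    refine subsingleton_of_forall_eq 0 fun z => ?_
    rw [← one_smul R z]
    exact smul_extMod_eq_zero ω 1 (fun y => Subsingleton.elim _ _) i z
  · intro N _ _ _ p e hN
    have hp : p.1 = IsLocalRing.maximalIdeal R := by
      refine (IsLocalRing.eq_maximalIdeal ?_)
      have hle : IsLocalRing.maximalIdeal R ≤ p.1 := by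
        refine p.2.le_of_pow_le (n := t) fun r hr => ?_
        have := hN r hr (e.symm (Ideal.Quotient.mk p.1 1))
        rw [← map_smul, LinearEquiv.map_eq_zero_iff] at this
        rw [← Ideal.Quotient.eq_zero_iff_mem]
        simpa [Algebra.smul_def] using this
      rw [← (IsLocalRing.maximalIdeal.isMaximal R).eq_of_le p.2.ne_top hle]
      infer_instance
    have := h.subsingleton i hi
    let e' : N ≃ₗ[R] IsLocalRing.ResidueField R := e ≪≫ₗ Submodule.quotEquivOfEq _ _ hp
    exact (extCongr ω e' i).symm.toEquiv.subsingleton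
  · intro N₁ _ _ _ N₂ _ _ _ N₃ _ _ _ f g hf hg hfg h1 h3 hN
    refine subsingleton_extMod_of_exact ω hf hfg hg i (h1 fun r hr y => hf ?_)
      (h3 fun r hr y => ?_)
    · rw [map_smul, map_zero, hN r hr]
    · obtain ⟨y, rfl⟩ := hg y
      rw [← map_smul, hN r hr, map_zero]

end Canonical

section WeightIdeal

variable {σ : Type} {K : Type} [Field K]

/-- The ideal of power series all of whose exponents have weight at least `t`. -/
def wtIdeal (w : (σ →₀ ℕ) →+ ℕ) (t : ℕ) : Ideal (MvPowerSeries σ K) where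
  carrier := {s | ∀ d, w d < t → coeff d s = 0}
  add_mem' := by
    intro a b ha hb d hd
    rw [map_add, ha d hd, hb d hd, add_zero]
  zero_mem' := by simp
  smul_mem' := by
    classical
    intro c x hx d hd
    rw [smul_eq_mul, coeff_mul]
    refine Finset.sum_eq_zero fun p hp => ?_
    have h : w p.1 + w p.2 = w d := by rw [← map_add, Finset.HasAntidiagonal.mem_antidiagonal.1 hp]
    rw [hx p.2 (by omega), mul_zero]

lemma monomial_mem_wtIdeal {w : (σ →₀ ℕ) →+ ℕ} {t : ℕ} {e : σ →₀ ℕ} (h : t ≤ w e) (c : K) :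
    monomial e c ∈ wtIdeal w t := by
  classical
  intro d hd
  rw [coeff_monomial, if_neg]
  rintro rfl
  omega

lemma X_mem_wtIdeal {w : (σ →₀ ℕ) →+ ℕ} {t : ℕ} {j : σ} (h : t ≤ w (Finsupp.single j 1)) :
    (X j : MvPowerSeries σ K) ∈ wtIdeal w t := monomial_mem_wtIdeal h 1

lemma wtIdeal_mono (w : (σ →₀ ℕ) →+ ℕ) {t u : ℕ} (h : t ≤ u) :
    (wtIdeal w u : Ideal (MvPowerSeries σ K)) ≤ wtIdeal w t :=
  fun _ hs d hd => hs d (hd.trans_le h)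

lemma wtIdeal_zero (w : (σ →₀ ℕ) →+ ℕ) : (wtIdeal w 0 : Ideal (MvPowerSeries σ K)) = ⊤ :=
  eq_top_iff.2 fun _ _ _ hd => absurd hd (Nat.not_lt_zero _)

lemma mul_mem_wtIdeal {w : (σ →₀ ℕ) →+ ℕ} {t u : ℕ} {a b : MvPowerSeries σ K}
    (ha : a ∈ wtIdeal w t) (hb : b ∈ wtIdeal w u) : a * b ∈ wtIdeal w (t + u) := by
  classical
  intro d hd
  rw [coeff_mul]
  refine Finset.sum_eq_zero fun p hp => ?_
  have h : w p.1 + w p.2 = w d := by rw [← map_add, Finset.HasAntidiagonal.mem_antidiagonal.1 hp]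
  by_cases h1 : w p.1 < t
  · rw [ha _ h1, zero_mul]
  · rw [hb p.2 (by omega), mul_zero]

lemma wtIdeal_one_pow_le (w : (σ →₀ ℕ) →+ ℕ) (t : ℕ) :
    (wtIdeal w 1 : Ideal (MvPowerSeries σ K)) ^ t ≤ wtIdeal w t := by
  induction t with
  | zero => rw [wtIdeal_zero]; exact le_top
  | succ t ih =>
    rw [pow_succ, Ideal.mul_le]
    exact fun a ha b hb => mul_mem_wtIdeal (ih ha) hb

lemma mem_span_monomial (B : Finset (σ →₀ ℕ)) (f : MvPowerSeries σ K)
    (h : ∀ e, coeff e f ≠ 0 → ∃ b ∈ B, b ≤ e) :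
    f ∈ Ideal.span ((fun b => (monomial b 1 : MvPowerSeries σ K)) '' B) := by
  classical
  have h' : ∀ e, ∃ b, coeff e f ≠ 0 → b ∈ B ∧ b ≤ e := fun e => by
    by_cases he : coeff e f = 0
    · exact ⟨0, fun h => absurd he h⟩
    · obtain ⟨b, hb, hbe⟩ := h e he
      exact ⟨b, fun _ => ⟨hb, hbe⟩⟩
  choose c hc using h'
  let g : (σ →₀ ℕ) → MvPowerSeries σ K :=
    fun b e => if c (b + e) = b then coeff (b + e) f else 0
  have hg : ∀ b e, coeff e (g b) = if c (b + e) = b then coeff (b + e) f else 0 :=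
    fun _ _ => rfl
  have hf : f = ∑ b ∈ B, g b * monomial b 1 := by
    ext e
    rw [map_sum]
    by_cases he : coeff e f = 0
    · rw [he]
      refine (Finset.sum_eq_zero fun b _ => ?_).symm
      rw [coeff_mul_monomial]
      split_ifs with hbe
      · rw [hg, add_tsub_cancel_of_le hbe, he]; simp
      · rfl
    · rw [Finset.sum_eq_single_of_mem (c e) (hc e he).1]
      · rw [coeff_mul_monomial, if_pos (hc e he).2, hg, add_tsub_cancel_of_le (hc e he).2,
          if_pos rfl, mul_one]
      · intro b _ hb
        rw [coeff_mul_monomial]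
        split_ifs with hbe
        · rw [hg, add_tsub_cancel_of_le hbe, if_neg (Ne.symm hb), zero_mul]
        · rfl
  rw [hf]
  exact Ideal.sum_mem _ fun b hb =>
    Ideal.mul_mem_left _ _ (Ideal.subset_span ⟨b, hb, rfl⟩)

/-- The partial degree in the variables of `T`. -/
def partialDegree (T : Finset σ) : (σ →₀ ℕ) →+ ℕ where
  toFun e := ∑ s ∈ T, e s
  map_zero' := by simp
  map_add' := by simp [Finset.sum_add_distrib]

lemma partialDegree_apply (T : Finset σ) (e : σ →₀ ℕ) : partialDegree T e = ∑ s ∈ T, e s := rfl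

lemma partialDegree_single [DecidableEq σ] (T : Finset σ) (s : σ) (k : ℕ) :
    partialDegree T (Finsupp.single s k) = if s ∈ T then k else 0 := by
  simp [partialDegree_apply, Finsupp.single_apply]

lemma exists_le_finsuppAntidiag [DecidableEq σ] (T : Finset σ) (N : ℕ) (e : σ →₀ ℕ)
    (h : N ≤ partialDegree T e) : ∃ b ∈ T.finsuppAntidiag N, b ≤ e := by
  induction N with
  | zero => exact ⟨0, by simp, zero_le⟩
  | succ N ih =>
    obtain ⟨b, hb, hbe⟩ := ih (by omega)
    rw [Finset.mem_finsuppAntidiag] at hb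
    obtain ⟨s, hs, hlt⟩ : ∃ s ∈ T, b s < e s := by
      by_contra! hcon
      have := Finset.sum_le_sum hcon
      rw [partialDegree_apply] at h
      have : ∑ i ∈ T, b i = N := hb.1
      omega
    refine ⟨b + Finsupp.single s 1, ?_, ?_⟩
    · rw [Finset.mem_finsuppAntidiag]
      refine ⟨?_, ?_⟩
      · have h1 : partialDegree T b = N := hb.1
        change partialDegree T _ = _
        rw [map_add, h1, partialDegree_single, if_pos hs]
      · refine Finsupp.support_add.trans (Finset.union_subset hb.2 ?_)
        exact Finsupp.support_single_subset.trans (by simpa using hs)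
    · intro r
      rcases eq_or_ne s r with rfl | hr
      · simpa using hlt
      · simpa [Finsupp.single_apply, hr] using hbe r

lemma monomial_mem_span_X_pow (T : Finset σ) (N : ℕ) (e : σ →₀ ℕ)
    (h : N ≤ partialDegree T e) :
    (monomial e 1 : MvPowerSeries σ K) ∈ Ideal.span ((X : σ → MvPowerSeries σ K) '' T) ^ N := by
  classical
  induction N generalizing e with
  | zero => simp
  | succ N ih =>
    obtain ⟨s, hs, hlt⟩ : ∃ s ∈ T, 0 < e s := by
      by_contra! hcon
      have := Finset.sum_nonpos hcon
      rw [partialDegree_apply] at h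
      omega
    have he : e = Finsupp.single s 1 + (e - Finsupp.single s 1) := by
      rw [add_tsub_cancel_of_le]
      simpa using Nat.succ_le_of_lt hlt
    have hd := congrArg (partialDegree T) he
    rw [map_add, partialDegree_single, if_pos hs] at hd
    have hm : (monomial e 1 : MvPowerSeries σ K) =
        monomial (e - Finsupp.single s 1) 1 * X s := by
      rw [X, monomial_mul_monomial, one_mul, add_comm, ← he]
    rw [hm, pow_succ]
    exact Ideal.mul_mem_mul (ih _ (by omega)) (Ideal.subset_span ⟨s, hs, rfl⟩)

lemma mem_span_X_pow (T : Finset σ) (N : ℕ) (f : MvPowerSeries σ K) :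
    f ∈ Ideal.span ((X : σ → MvPowerSeries σ K) '' T) ^ N ↔
      f ∈ wtIdeal (partialDegree T) N := by
  classical
  constructor
  · intro h
    refine wtIdeal_one_pow_le _ _ (Ideal.pow_right_mono (Ideal.span_le.2 ?_) N h)
    rintro _ ⟨s, hs, rfl⟩
    exact X_mem_wtIdeal (by rw [partialDegree_single, if_pos (by simpa using hs)])
  · intro h
    refine (Ideal.span_le.2 ?_) (mem_span_monomial (T.finsuppAntidiag N) f fun e he =>
      exists_le_finsuppAntidiag T N e ?_)
    · rintro _ ⟨b, hb, rfl⟩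
      refine monomial_mem_span_X_pow T N b ?_
      rw [Finset.mem_coe, Finset.mem_finsuppAntidiag] at hb
      rw [partialDegree_apply, hb.1]
    · by_contra! hlt
      exact he (h e hlt)

end WeightIdeal

section Monomials

variable (m n : ℕ)

/-- The exponent of the image of `x_{ij}` under `φ`. -/
def phiExpVar (p : Fin m × Fin n) : Fin m ⊕ Fin (n - 1) →₀ ℕ :=
  Finsupp.single (Sum.inl p.1) 1 +
    if h : (p.2 : ℕ) < n - 1 then Finsupp.single (Sum.inr ⟨p.2, h⟩) 1 else 0

/-- The exponent of the image of a monomial under `φ`. -/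
def phiExp : (Fin m × Fin n →₀ ℕ) →ₗ[ℕ] (Fin m ⊕ Fin (n - 1) →₀ ℕ) :=
  Finsupp.linearCombination ℕ (phiExpVar m n)

lemma phiExp_single (p : Fin m × Fin n) :
    phiExp m n (Finsupp.single p 1) = phiExpVar m n p := by
  simp [phiExp]

/-- The variables `x_i`. -/
def xVars : Finset (Fin m ⊕ Fin (n - 1)) := Finset.univ.filter fun s => s.isLeft

/-- The variables `a_j`. -/
def aVars : Finset (Fin m ⊕ Fin (n - 1)) := Finset.univ.filter fun s => s.isRight

/-- The positions in the first `n - 1` columns. -/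
def firstCols : Finset (Fin m × Fin n) := Finset.univ.filter fun p => (p.2 : ℕ) < n - 1

/-- The degree in the `x_i`. -/
abbrev xdeg : (Fin m ⊕ Fin (n - 1) →₀ ℕ) →+ ℕ := partialDegree (xVars m n)

/-- The degree in the `a_j`. -/
abbrev adeg : (Fin m ⊕ Fin (n - 1) →₀ ℕ) →+ ℕ := partialDegree (aVars m n)

variable {m n}

lemma inl_mem_xVars (i : Fin m) : (Sum.inl i : Fin m ⊕ Fin (n - 1)) ∈ xVars m n := by
  simp [xVars]

lemma inr_notMem_xVars (j : Fin (n - 1)) : (Sum.inr j : Fin m ⊕ Fin (n - 1)) ∉ xVars m n := by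
  simp [xVars]

lemma inl_notMem_aVars (i : Fin m) : (Sum.inl i : Fin m ⊕ Fin (n - 1)) ∉ aVars m n := by
  simp [aVars]

lemma inr_mem_aVars (j : Fin (n - 1)) : (Sum.inr j : Fin m ⊕ Fin (n - 1)) ∈ aVars m n := by
  simp [aVars]

lemma addHom_phiExp {M : Type} [AddCommMonoid M] (F : (Fin m ⊕ Fin (n - 1) →₀ ℕ) →+ M)
    (G : (Fin m × Fin n →₀ ℕ) →+ M)
    (h : ∀ p, F (phiExpVar m n p) = G (Finsupp.single p 1)) (e : Fin m × Fin n →₀ ℕ) :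
    F (phiExp m n e) = G e := by
  have : F.comp (phiExp m n).toAddMonoidHom = G := by
    ext p
    simpa [phiExp_single] using h p
  exact DFunLike.congr_fun this e

lemma xdeg_phiExp (e : Fin m × Fin n →₀ ℕ) :
    xdeg m n (phiExp m n e) = partialDegree Finset.univ e := by
  refine addHom_phiExp _ _ (fun p => ?_) e
  rw [phiExpVar, map_add, partialDegree_single, partialDegree_single, if_pos (inl_mem_xVars _),
    if_pos (Finset.mem_univ _)]
  split_ifs with h
  · rw [partialDegree_single, if_neg (inr_notMem_xVars _)]
  · rw [map_zero, add_zero]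

lemma adeg_phiExp (e : Fin m × Fin n →₀ ℕ) :
    adeg m n (phiExp m n e) = partialDegree (firstCols m n) e := by
  refine addHom_phiExp _ _ (fun p => ?_) e
  rw [phiExpVar, map_add, partialDegree_single, partialDegree_single, if_neg (inl_notMem_aVars _)]
  split_ifs with h h' h'
  · rw [partialDegree_single, if_pos (inr_mem_aVars _)]
  · simp [firstCols, h] at h'
  · simp [firstCols, h] at h'
  · simp

/-- The row sums are determined by `phiExp`. -/
lemma phiExp_inl (e : Fin m × Fin n →₀ ℕ) (i : Fin m) :
    phiExp m n e (Sum.inl i) = partialDegree (Finset.univ.filter fun p => p.1 = i) e := by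
  refine addHom_phiExp (Finsupp.applyAddHom (Sum.inl i)) _ (fun p => ?_) e
  rw [phiExpVar, partialDegree_single]
  split_ifs with h h' h' <;> simp_all

lemma phiExp_inr (e : Fin m × Fin n →₀ ℕ) (j : Fin (n - 1)) :
    phiExp m n e (Sum.inr j) =
      partialDegree (Finset.univ.filter fun p => (p.2 : ℕ) = j) e := by
  refine addHom_phiExp (Finsupp.applyAddHom (Sum.inr j)) _ (fun p => ?_) e
  rw [phiExpVar, partialDegree_single]
  split_ifs with h h' h'
  · simp_all
  · simp_all [Fin.ext_iff]
  · have := j.2; simp at h'; omega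
  · simp

/-- The column sums are determined by `phiExp`. -/
lemma colSum_eq_of_phiExp_eq {e e' : Fin m × Fin n →₀ ℕ} (h : phiExp m n e = phiExp m n e')
    (j : Fin n) :
    partialDegree (Finset.univ.filter fun p : Fin m × Fin n => p.2 = j) e =
      partialDegree (Finset.univ.filter fun p => p.2 = j) e' := by
  by_cases hj : (j : ℕ) < n - 1
  · have := DFunLike.congr_fun h (Sum.inr ⟨j, hj⟩)
    simpa [phiExp_inr, Fin.val_inj] using this
  · have key : ∀ e : Fin m × Fin n →₀ ℕ, partialDegree Finset.univ e =
        partialDegree (firstCols m n) e +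
          partialDegree (Finset.univ.filter fun p : Fin m × Fin n => p.2 = j) e := by
      intro e
      rw [partialDegree_apply, partialDegree_apply, partialDegree_apply, firstCols,
        ← Finset.sum_filter_add_sum_filter_not _ (fun p : Fin m × Fin n => (p.2 : ℕ) < n - 1)]
      congr 2
      ext p
      have := p.2.2
      have := j.2
      simp [Fin.ext_iff]
      omega
    have h1 := key e
    have h2 := key e'
    rw [← xdeg_phiExp, ← adeg_phiExp] at h1 h2
    rw [h] at h1
    omega

lemma exists_phiExp_eq (d : Fin m ⊕ Fin (n - 1) →₀ ℕ) (hd : adeg m n d ≤ xdeg m n d)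
    (hn : 1 ≤ n) : ∃ e, phiExp m n e = d := by
  classical
  induction hN : xdeg m n d generalizing d with
  | zero =>
    refine ⟨0, ?_⟩
    have ha : adeg m n d = 0 := by omega
    rw [partialDegree_apply, Finset.sum_eq_zero_iff] at ha hN
    ext s
    rcases s with i | j
    · simpa using (hN _ (inl_mem_xVars i)).symm
    · simpa using (ha _ (inr_mem_aVars j)).symm
  | succ N ih =>
    obtain ⟨s, hs, hlt⟩ : ∃ s ∈ xVars m n, 0 < d s := by
      by_contra! hcon
      have := Finset.sum_nonpos hcon
      rw [partialDegree_apply] at hN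
      omega
    rcases s with i | j
    swap
    · exact absurd hs (inr_notMem_xVars j)
    have hsplit : d = Finsupp.single (Sum.inl i) 1 + (d - Finsupp.single (Sum.inl i) 1) := by
      rw [add_tsub_cancel_of_le]
      simpa using Nat.succ_le_of_lt hlt
    set d' := d - Finsupp.single (Sum.inl i) 1
    have hx := congrArg (xdeg m n) hsplit
    have ha := congrArg (adeg m n) hsplit
    rw [map_add, partialDegree_single, if_pos hs] at hx
    rw [map_add, partialDegree_single, if_neg (inl_notMem_aVars i)] at ha
    by_cases h0 : adeg m n d = 0
    · obtain ⟨e, he⟩ := ih d' (by omega) (by omega)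
      refine ⟨Finsupp.single (i, ⟨n - 1, by omega⟩) 1 + e, ?_⟩
      rw [map_add, phiExp_single, he, hsplit, phiExpVar, dif_neg (by simp), add_zero]
    · obtain ⟨s, hs', hlt'⟩ : ∃ s ∈ aVars m n, 0 < d' s := by
        by_contra! hcon
        have : adeg m n d' ≤ 0 := Finset.sum_nonpos hcon
        omega
      rcases s with i' | j
      · exact absurd hs' (inl_notMem_aVars i')
      have hsplit' : d' = Finsupp.single (Sum.inr j) 1 + (d' - Finsupp.single (Sum.inr j) 1) := by
        rw [add_tsub_cancel_of_le]
        simpa using Nat.succ_le_of_lt hlt'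
      set d'' := d' - Finsupp.single (Sum.inr j) 1
      have hx' := congrArg (xdeg m n) hsplit'
      have ha' := congrArg (adeg m n) hsplit'
      rw [map_add, partialDegree_single, if_neg (inr_notMem_xVars j)] at hx'
      rw [map_add, partialDegree_single, if_pos hs'] at ha'
      obtain ⟨e, he⟩ := ih d'' (by omega) (by omega)
      refine ⟨Finsupp.single (i, ⟨j, by omega⟩) 1 + e, ?_⟩
      rw [map_add, phiExp_single, he, hsplit, hsplit', phiExpVar, dif_pos j.2, add_assoc]

/-- The finitely many exponents with a given image under `phiExp`. -/
def phiFiber (d : Fin m ⊕ Fin (n - 1) →₀ ℕ) : Finset (Fin m × Fin n →₀ ℕ) :=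
  (Finset.univ.finsuppAntidiag (xdeg m n d)).filter fun e => phiExp m n e = d

lemma mem_phiFiber {d : Fin m ⊕ Fin (n - 1) →₀ ℕ} {e : Fin m × Fin n →₀ ℕ} :
    e ∈ phiFiber d ↔ phiExp m n e = d := by
  rw [phiFiber, Finset.mem_filter, Finset.mem_finsuppAntidiag]
  refine ⟨fun h => h.2, fun h => ⟨⟨?_, Finset.subset_univ _⟩, h⟩⟩
  rw [← h, xdeg_phiExp]
  rfl

end Monomials

section LowDegree

variable {σ : Type} [Fintype σ] [DecidableEq σ]

/-- The exponents of total degree at most `N`. -/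
def lowExponents (σ : Type) [Fintype σ] [DecidableEq σ] (N : ℕ) : Finset (σ →₀ ℕ) :=
  (Finset.range (N + 1)).biUnion fun k => Finset.univ.finsuppAntidiag k

lemma mem_lowExponents {N : ℕ} {e : σ →₀ ℕ} :
    e ∈ lowExponents σ N ↔ partialDegree Finset.univ e ≤ N := by
  simp only [lowExponents, Finset.mem_biUnion, Finset.mem_range, Finset.mem_finsuppAntidiag,
    Finset.subset_univ, and_true, exists_eq_right']
  exact Nat.lt_succ_iff

lemma sub_truncation_mem {K : Type} [Field K] (N : ℕ) (f : MvPowerSeries σ K) :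
    f - ∑ e ∈ lowExponents σ N, monomial e (coeff e f) ∈
      wtIdeal (partialDegree Finset.univ) (N + 1) := by
  intro d hd
  rw [map_sub, map_sum, sub_eq_zero, Finset.sum_eq_single_of_mem d
    (mem_lowExponents.2 (Nat.lt_succ_iff.1 hd)), coeff_monomial_same]
  exact fun e _ he => coeff_monomial_ne he.symm _

end LowDegree

section Kernel

variable {𝕜 : Type} [Field 𝕜] {m n : ℕ}

lemma X_mul_X_sub_mem_detI2 (i k : Fin m) (j l : Fin n) :
    (X (i, j) * X (k, l) - X (i, l) * X (k, j) : DetP 𝕜 m n) ∈ detI2 𝕜 m n := by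
  have key : ∀ (i k : Fin m) (j l : Fin n), i < k → j < l →
      (X (i, j) * X (k, l) - X (i, l) * X (k, j) : DetP 𝕜 m n) ∈ detI2 𝕜 m n :=
    fun i k j l h1 h2 => Ideal.subset_span ⟨i, k, j, l, h1, h2, rfl⟩
  rcases lt_trichotomy i k with h1 | rfl | h1
  · rcases lt_trichotomy j l with h2 | rfl | h2
    · exact key i k j l h1 h2
    · simp
    · have := neg_mem (key i k l j h1 h2)
      convert this using 1; ring
  · convert Submodule.zero_mem (detI2 𝕜 m n) using 1; ring
  · rcases lt_trichotomy j l with h2 | rfl | h2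
    · have := neg_mem (key k i j l h1 h2)
      convert this using 1; ring
    · simp
    · convert key k i l j h1 h2 using 1; ring

variable (𝕜) in
/-- The class in `R` of a monomial. -/
def detMonomial (e : Fin m × Fin n →₀ ℕ) : DetR 𝕜 m n :=
  Ideal.Quotient.mk (detI2 𝕜 m n) (monomial e 1)

lemma detMonomial_add (e f : Fin m × Fin n →₀ ℕ) :
    detMonomial 𝕜 (e + f) = detMonomial 𝕜 e * detMonomial 𝕜 f := by
  rw [detMonomial, detMonomial, detMonomial, ← map_mul, monomial_mul_monomial, one_mul]

lemma detMonomial_exchange (i k : Fin m) (j l : Fin n) :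
    detMonomial 𝕜 (Finsupp.single (i, l) 1 + Finsupp.single (k, j) 1) =
      detMonomial 𝕜 (Finsupp.single (i, j) 1 + Finsupp.single (k, l) 1) := by
  rw [detMonomial_add, detMonomial_add]
  simp only [detMonomial, ← map_mul]
  rw [eq_comm, Ideal.Quotient.eq]
  exact X_mul_X_sub_mem_detI2 i k j l

lemma exists_pos_of_partialDegree_ne_zero {σ : Type} {T : Finset σ} {e : σ →₀ ℕ}
    (h : partialDegree T e ≠ 0) : ∃ s ∈ T, 0 < e s := by
  by_contra! hcon
  exact h (Nat.le_zero.1 (Finset.sum_nonpos hcon))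

lemma partialDegree_pos {σ : Type} {T : Finset σ} {e : σ →₀ ℕ} {s : σ} (hs : s ∈ T)
    (h : 0 < e s) : partialDegree T e ≠ 0 :=
  (h.trans_le (Finset.single_le_sum (f := e) (fun _ _ => Nat.zero_le _) hs)).ne'

lemma exists_eq_single_add {σ : Type} {e : σ →₀ ℕ} {s : σ} (h : 0 < e s) :
    ∃ f, e = Finsupp.single s 1 + f :=
  ⟨e - Finsupp.single s 1, by
    rw [add_tsub_cancel_of_le]
    simpa using Nat.succ_le_of_lt h⟩

lemma detMonomial_eq_of_phiExp_eq {e e' : Fin m × Fin n →₀ ℕ}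
    (h : phiExp m n e = phiExp m n e') : detMonomial 𝕜 e = detMonomial 𝕜 e' := by
  classical
  induction hN : partialDegree Finset.univ e generalizing e e' with
  | zero =>
    have hN' : partialDegree Finset.univ e' = 0 := by
      rw [← hN, ← xdeg_phiExp, ← xdeg_phiExp, h]
    have key : ∀ f : Fin m × Fin n →₀ ℕ, partialDegree Finset.univ f = 0 → f = 0 := by
      intro f hf
      rw [partialDegree_apply, Finset.sum_eq_zero_iff] at hf
      ext s
      exact hf s (Finset.mem_univ s)
    rw [key e hN, key e' hN']
  | succ N ih =>
    obtain ⟨⟨i, j⟩, -, hp⟩ := exists_pos_of_partialDegree_ne_zero (hN.trans_ne N.succ_ne_zero)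
    obtain ⟨f, rfl⟩ := exists_eq_single_add hp
    have hfN : partialDegree Finset.univ f = N := by
      rw [map_add, partialDegree_single, if_pos (Finset.mem_univ _)] at hN
      omega
    suffices hs : ∃ f', detMonomial 𝕜 e' = detMonomial 𝕜 (Finsupp.single (i, j) 1 + f') ∧
        phiExp m n e' = phiExp m n (Finsupp.single (i, j) 1 + f') by
      obtain ⟨f', h1, h2⟩ := hs
      rw [h1, detMonomial_add, detMonomial_add]
      rw [h2, map_add, map_add] at h
      rw [ih (add_left_cancel h) hfN]
    obtain ⟨⟨i', l⟩, hi, hl⟩ := exists_pos_of_partialDegree_ne_zero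
      (T := Finset.univ.filter fun p : Fin m × Fin n => p.1 = i) (e := e') (by
        rw [← phiExp_inl, ← h, phiExp_inl]
        exact partialDegree_pos (by simp) hp)
    obtain ⟨⟨k, j'⟩, hj, hk⟩ := exists_pos_of_partialDegree_ne_zero
      (T := Finset.univ.filter fun p : Fin m × Fin n => p.2 = j) (e := e') (by
        rw [← colSum_eq_of_phiExp_eq h]
        exact partialDegree_pos (by simp) hp)
    obtain rfl : i' = i := by simpa using hi
    obtain rfl : j' = j := by simpa using hj
    obtain ⟨g, rfl⟩ := exists_eq_single_add hl
    by_cases hlj : l = j'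
    · subst hlj
      exact ⟨g, rfl, rfl⟩
    · rw [Finsupp.add_apply, Finsupp.single_eq_of_ne (by simp [Ne.symm hlj]), zero_add] at hk
      obtain ⟨g', rfl⟩ := exists_eq_single_add hk
      refine ⟨Finsupp.single (k, l) 1 + g', ?_, ?_⟩
      · rw [← add_assoc, ← add_assoc, detMonomial_add, detMonomial_exchange, ← detMonomial_add]
      · simp only [map_add, phiExp_single, phiExpVar]
        abel

variable (φ : DetR 𝕜 m n →ₐ[𝕜] DetS 𝕜 m n) (hφ : IsDetPhi 𝕜 m n φ)

include hφ

lemma phi_detMonomial (e : Fin m × Fin n →₀ ℕ) :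
    φ (detMonomial 𝕜 e) = monomial (phiExp m n e) 1 := by
  induction e using Finsupp.induction_linear with
  | zero => simp [detMonomial]
  | add e f he hf =>
    rw [detMonomial_add, map_mul, he, hf, monomial_mul_monomial, one_mul, map_add]
  | single p k =>
    have h1 : φ (detMonomial 𝕜 (Finsupp.single p 1)) = monomial (phiExpVar m n p) 1 := by
      change φ (detx 𝕜 m n p.1 p.2) = _
      rw [hφ, phiExpVar]
      split_ifs with h
      · rw [X, X, monomial_mul_monomial, one_mul, add_comm]
      · rw [add_zero]; rfl
    have h2 : detMonomial 𝕜 (Finsupp.single p k) = detMonomial 𝕜 (Finsupp.single p 1) ^ k := by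
      simp only [detMonomial]
      rw [← map_pow, monomial_pow, one_pow, Finsupp.smul_single', mul_one]
    rw [h2, map_pow, h1, monomial_pow, one_pow, ← phiExp_single, ← map_nsmul,
      Finsupp.smul_single', mul_one]

lemma phi_mk_monomial (e : Fin m × Fin n →₀ ℕ) (c : 𝕜) :
    φ (Ideal.Quotient.mk _ (monomial e c)) = monomial (phiExp m n e) c := by
  have h : (monomial e c : DetP 𝕜 m n) = c • monomial e 1 := by
    rw [← map_smul, smul_eq_mul, mul_one]
  have h2 : Ideal.Quotient.mk (detI2 𝕜 m n) (c • monomial e 1) = c • detMonomial 𝕜 e := rfl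
  rw [h, h2, map_smul, phi_detMonomial φ hφ, ← map_smul, smul_eq_mul, mul_one]

lemma phi_mk_mem_wtIdeal {N : ℕ} {f : DetP 𝕜 m n}
    (hf : f ∈ wtIdeal (partialDegree Finset.univ) N) :
    φ (Ideal.Quotient.mk _ f) ∈ wtIdeal (xdeg m n) N := by
  classical
  rw [← mem_span_X_pow] at hf
  have h1 : Ideal.span ((X : Fin m × Fin n → DetP 𝕜 m n) '' ((Finset.univ : Finset (Fin m × Fin n)) : Set (Fin m × Fin n))) ≤
      (wtIdeal (xdeg m n) 1).comap (φ.toRingHom.comp (Ideal.Quotient.mk (detI2 𝕜 m n))) := by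
    rw [Ideal.span_le]
    rintro _ ⟨p, -, rfl⟩
    change φ (detMonomial 𝕜 (Finsupp.single p 1)) ∈ wtIdeal (xdeg m n) 1
    rw [phi_detMonomial φ hφ]
    refine monomial_mem_wtIdeal ?_ 1
    rw [xdeg_phiExp, partialDegree_single, if_pos (Finset.mem_univ _)]
  have h2 := Ideal.pow_right_mono h1 N hf
  exact wtIdeal_one_pow_le _ N (Ideal.le_comap_pow (φ.toRingHom.comp
    (Ideal.Quotient.mk (detI2 𝕜 m n))) N h2)

lemma coeff_phi_mk (f : DetP 𝕜 m n) (d : Fin m ⊕ Fin (n - 1) →₀ ℕ) :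
    coeff d (φ (Ideal.Quotient.mk _ f)) = ∑ e ∈ phiFiber d, coeff e f := by
  classical
  have h := phi_mk_mem_wtIdeal φ hφ (sub_truncation_mem (xdeg m n d) f) d (Nat.lt_succ_self _)
  rw [map_sub, map_sub, map_sub, sub_eq_zero] at h
  rw [h, map_sum, map_sum, map_sum]
  simp_rw [phi_mk_monomial φ hφ, coeff_monomial]
  rw [← Finset.sum_filter]
  refine Finset.sum_congr ?_ fun _ _ => rfl
  ext e
  rw [Finset.mem_filter, mem_lowExponents, mem_phiFiber]
  refine ⟨fun h => h.2.symm, fun h => ⟨?_, h.symm⟩⟩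
  rw [← h, xdeg_phiExp]

lemma exists_phi_eq (hn : 1 ≤ n) (s : DetS 𝕜 m n)
    (hs : ∀ d, coeff d s ≠ 0 → adeg m n d ≤ xdeg m n d) : ∃ r, φ r = s := by
  classical
  let f : DetP 𝕜 m n := fun e => if Function.invFun (phiExp m n) (phiExp m n e) = e then
    coeff (phiExp m n e) s else 0
  have hf : ∀ e, coeff e f = if Function.invFun (phiExp m n) (phiExp m n e) = e then
    coeff (phiExp m n e) s else 0 := fun _ => rfl
  refine ⟨Ideal.Quotient.mk _ f, ?_⟩
  ext d
  rw [coeff_phi_mk φ hφ]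
  by_cases hd : coeff d s = 0
  · rw [hd]
    refine Finset.sum_eq_zero fun e he => ?_
    rw [hf, mem_phiFiber.1 he, hd, ite_self]
  · obtain hex := exists_phiExp_eq d (hs d hd) hn
    have hinv := Function.invFun_eq hex
    rw [Finset.sum_eq_single_of_mem _ (mem_phiFiber.2 hinv), hf, hinv, if_pos rfl]
    intro e he hne
    rw [hf, mem_phiFiber.1 he, if_neg (Ne.symm hne)]

lemma phi_injective [IsLocalRing (DetR 𝕜 m n)] : Function.Injective φ := by
  classical
  rw [injective_iff_map_eq_zero]
  intro r hr
  obtain ⟨f, rfl⟩ := Ideal.Quotient.mk_surjective r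
  let 𝔫 : Ideal (DetP 𝕜 m n) :=
    Ideal.span ((X : Fin m × Fin n → DetP 𝕜 m n) '' ((Finset.univ : Finset (Fin m × Fin n)) : Set (Fin m × Fin n)))
  have hmem : ∀ N, Ideal.Quotient.mk (detI2 𝕜 m n) f ∈
      (𝔫.map (Ideal.Quotient.mk (detI2 𝕜 m n))) ^ N := by
    intro N
    have htail := Ideal.mem_map_of_mem (Ideal.Quotient.mk (detI2 𝕜 m n))
      ((mem_span_X_pow _ _ _).2 (sub_truncation_mem N f))
    rw [Ideal.map_pow] at htail
    have hzero : Ideal.Quotient.mk (detI2 𝕜 m n)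
        (∑ e ∈ lowExponents (Fin m × Fin n) N, monomial e (coeff e f)) = 0 := by
      have h1 : ∀ e : Fin m × Fin n →₀ ℕ,
          Ideal.Quotient.mk (detI2 𝕜 m n) (monomial e (coeff e f)) = coeff e f •
            detMonomial 𝕜 (Function.invFun (phiExp m n) (phiExp m n e)) := by
        intro e
        rw [detMonomial_eq_of_phiExp_eq (e' := e) (Function.invFun_eq ⟨e, rfl⟩)]
        have h : (monomial e (coeff e f) : DetP 𝕜 m n) = coeff e f • monomial e 1 := by
          rw [← map_smul, smul_eq_mul, mul_one]
        rw [h]; rfl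
      rw [map_sum]
      simp_rw [h1]
      rw [← Finset.sum_fiberwise_of_maps_to (t := (lowExponents _ N).image (phiExp m n))
        (fun e he => Finset.mem_image_of_mem _ he)]
      refine Finset.sum_eq_zero fun d hd => ?_
      obtain ⟨e₀, he₀, rfl⟩ := Finset.mem_image.1 hd
      have h2 := coeff_phi_mk φ hφ f (phiExp m n e₀)
      rw [hr, map_zero] at h2
      have h3 : ((lowExponents _ N).filter fun e => phiExp m n e = phiExp m n e₀) =
          phiFiber (phiExp m n e₀) := by
        ext e
        rw [Finset.mem_filter, mem_phiFiber, mem_lowExponents]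
        refine ⟨fun h => h.2, fun h => ⟨?_, h⟩⟩
        rw [← xdeg_phiExp, h, xdeg_phiExp]
        exact mem_lowExponents.1 he₀
      rw [h3, Finset.sum_congr rfl (g := fun e => coeff e f •
        detMonomial 𝕜 (Function.invFun (phiExp m n) (phiExp m n e₀)))
        (fun e he => by rw [mem_phiFiber.1 he]), ← Finset.sum_smul, ← h2, zero_smul]
    rw [map_sub, hzero, sub_zero] at htail
    exact Ideal.pow_le_pow_right (Nat.le_succ N) htail
  have hne : 𝔫.map (Ideal.Quotient.mk (detI2 𝕜 m n)) ≠ ⊤ := by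
    intro htop
    have h1 : 𝔫.map (Ideal.Quotient.mk (detI2 𝕜 m n)) ≤ (wtIdeal (xdeg m n) 1).comap φ := by
      rw [Ideal.map_le_iff_le_comap]
      intro f hf
      refine phi_mk_mem_wtIdeal φ hφ ?_
      rw [← mem_span_X_pow, pow_one]
      exact hf
    have h2 : (1 : DetR 𝕜 m n) ∈ (wtIdeal (xdeg m n) 1).comap φ := h1 (htop ▸ Submodule.mem_top)
    rw [Ideal.mem_comap, map_one] at h2
    have := h2 0 (by simp)
    simp at this
  have := Ideal.iInf_pow_eq_bot_of_isLocalRing _ hne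
  have h0 := (Ideal.mem_iInf).2 hmem
  rwa [this, Ideal.mem_bot] at h0

end Kernel

section Ideals

variable {𝕜 : Type} [Field 𝕜] {m n : ℕ}

lemma detJ_eq_map : detJ 𝕜 m n =
    (Ideal.span ((X : Fin m × Fin n → DetP 𝕜 m n) '' (firstCols m n : Set (Fin m × Fin n)))).map
      (Ideal.Quotient.mk (detI2 𝕜 m n)) := by
  rw [Ideal.map_span, detJ]
  congr 1
  ext x
  constructor
  · rintro ⟨i, j, hj, rfl⟩
    exact ⟨_, ⟨(i, j), by simpa [firstCols] using hj, rfl⟩, rfl⟩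
  · rintro ⟨_, ⟨⟨i, j⟩, hj, rfl⟩, rfl⟩
    exact ⟨i, j, by simpa [firstCols] using hj, rfl⟩

lemma maximalIdeal_detR_le [IsLocalRing (DetR 𝕜 m n)] :
    IsLocalRing.maximalIdeal (DetR 𝕜 m n) ≤
      (Ideal.span ((X : Fin m × Fin n → DetP 𝕜 m n) ''
        ((Finset.univ : Finset (Fin m × Fin n)) : Set (Fin m × Fin n)))).map
        (Ideal.Quotient.mk (detI2 𝕜 m n)) := by
  intro r hr
  obtain ⟨f, rfl⟩ := Ideal.Quotient.mk_surjective r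
  refine Ideal.mem_map_of_mem _ ?_
  rw [← pow_one (Ideal.span _), mem_span_X_pow]
  intro d hd
  have hd0 : d = 0 := by
    rw [partialDegree_apply, Nat.lt_one_iff, Finset.sum_eq_zero_iff] at hd
    ext s
    exact hd s (Finset.mem_univ s)
  subst hd0
  by_contra h
  rw [IsLocalRing.mem_maximalIdeal, mem_nonunits_iff] at hr
  refine hr (IsUnit.map _ ?_)
  rw [MvPowerSeries.isUnit_iff_constantCoeff]
  exact isUnit_iff_ne_zero.2 h

variable (φ : DetR 𝕜 m n →ₐ[𝕜] DetS 𝕜 m n) (hφ : IsDetPhi 𝕜 m n φ)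

include hφ

lemma phi_mem_of_mem_maximalIdeal_pow [IsLocalRing (DetR 𝕜 m n)] {r : DetR 𝕜 m n} {t : ℕ}
    (hr : r ∈ IsLocalRing.maximalIdeal (DetR 𝕜 m n) ^ t) : φ r ∈ wtIdeal (xdeg m n) t := by
  have h := Ideal.pow_right_mono maximalIdeal_detR_le t hr
  rw [← Ideal.map_pow] at h
  obtain ⟨f, hf, rfl⟩ := (Ideal.mem_map_iff_of_surjective _ Ideal.Quotient.mk_surjective).1 h
  exact phi_mk_mem_wtIdeal φ hφ ((mem_span_X_pow _ _ _).1 hf)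

lemma phi_mem_of_mem_detJ_pow {r : DetR 𝕜 m n} {t : ℕ} (hr : r ∈ detJ 𝕜 m n ^ t) :
    φ r ∈ wtIdeal (adeg m n) t := by
  have h1 : detJ 𝕜 m n ≤ (wtIdeal (adeg m n) 1).comap φ := by
    rw [detJ, Ideal.span_le]
    rintro _ ⟨i, j, hj, rfl⟩
    change φ _ ∈ wtIdeal (adeg m n) 1
    rw [hφ, dif_pos hj]
    refine Ideal.mul_mem_right _ _ (X_mem_wtIdeal ?_)
    rw [partialDegree_single, if_pos (inr_mem_aVars _)]
  have h2 := Ideal.pow_right_mono h1 t hr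
  exact wtIdeal_one_pow_le _ t (Ideal.le_comap_pow φ t h2)

lemma mem_detJ_pow_iff [IsLocalRing (DetR 𝕜 m n)] {r : DetR 𝕜 m n} {t : ℕ} :
    r ∈ detJ 𝕜 m n ^ t ↔ φ r ∈ wtIdeal (adeg m n) t := by
  classical
  refine ⟨phi_mem_of_mem_detJ_pow φ hφ, fun h => ?_⟩
  obtain ⟨f, rfl⟩ := Ideal.Quotient.mk_surjective r
  let f₁ : DetP 𝕜 m n := fun e => if partialDegree (firstCols m n) e < t then coeff e f else 0
  have hf₁ : ∀ e, coeff e f₁ = if partialDegree (firstCols m n) e < t then coeff e f else 0 :=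
    fun _ => rfl
  have h1 : Ideal.Quotient.mk (detI2 𝕜 m n) f₁ = 0 := by
    refine phi_injective φ hφ ?_
    rw [map_zero]
    ext d
    rw [coeff_phi_mk φ hφ, map_zero]
    by_cases hd : adeg m n d < t
    · rw [← h d hd, coeff_phi_mk φ hφ]
      refine Finset.sum_congr rfl fun e he => ?_
      rw [hf₁, if_pos]
      rwa [← adeg_phiExp, mem_phiFiber.1 he]
    · refine Finset.sum_eq_zero fun e he => ?_
      rw [hf₁, if_neg]
      rwa [← adeg_phiExp, mem_phiFiber.1 he]
  rw [← sub_zero (Ideal.Quotient.mk (detI2 𝕜 m n) f), ← h1, ← map_sub, detJ_eq_map,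
    ← Ideal.map_pow]
  refine Ideal.mem_map_of_mem _ ((mem_span_X_pow _ _ _).2 fun e he => ?_)
  rw [map_sub, hf₁, if_pos he, sub_self]

end Ideals

section PhiQuot

variable {𝕜 : Type} [Field 𝕜] {m n : ℕ} (φ : DetR 𝕜 m n →ₐ[𝕜] DetS 𝕜 m n)

/-- The quotient `S/J` as a module over `R`. -/
def PhiQuot (_ : DetR 𝕜 m n →ₐ[𝕜] DetS 𝕜 m n) (J : Ideal (DetS 𝕜 m n)) : Type := DetS 𝕜 m n ⧸ J

variable (J J₂ : Ideal (DetS 𝕜 m n))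

instance : AddCommGroup (PhiQuot φ J) := inferInstanceAs (AddCommGroup (DetS 𝕜 m n ⧸ J))

instance : Module (DetS 𝕜 m n) (PhiQuot φ J) :=
  inferInstanceAs (Module (DetS 𝕜 m n) (DetS 𝕜 m n ⧸ J))

instance : Module (DetR 𝕜 m n) (PhiQuot φ J) := Module.compHom _ φ.toRingHom

namespace PhiQuot

variable {J J₂}

/-- The class of a power series. -/
def mk (s : DetS 𝕜 m n) : PhiQuot φ J := Ideal.Quotient.mk J s

lemma mk_surjective : Function.Surjective (mk φ : DetS 𝕜 m n → PhiQuot φ J) :=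
  Ideal.Quotient.mk_surjective

lemma mk_eq_zero {s : DetS 𝕜 m n} : (mk φ s : PhiQuot φ J) = 0 ↔ s ∈ J :=
  Ideal.Quotient.eq_zero_iff_mem

lemma mk_eq_mk {s s' : DetS 𝕜 m n} : (mk φ s : PhiQuot φ J) = mk φ s' ↔ s - s' ∈ J :=
  Ideal.Quotient.eq

lemma smul_mk (s s' : DetS 𝕜 m n) : (s • mk φ s' : PhiQuot φ J) = mk φ (s * s') := rfl

lemma smul_eq (r : DetR 𝕜 m n) (y : PhiQuot φ J) : r • y = φ r • y := rfl

lemma mk_add (s s' : DetS 𝕜 m n) : (mk φ (s + s') : PhiQuot φ J) = mk φ s + mk φ s' := rfl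

/-- Multiplication by `s`, as a map `S/J → S/J₂`. -/
def mulMap (s : DetS 𝕜 m n) (h : ∀ y ∈ J, s * y ∈ J₂) :
    PhiQuot φ J →ₗ[DetR 𝕜 m n] PhiQuot φ J₂ where
  toFun := Submodule.mapQ J J₂ (LinearMap.mulLeft (DetS 𝕜 m n) s) h
  map_add' := map_add (Submodule.mapQ J J₂ (LinearMap.mulLeft (DetS 𝕜 m n) s) h)
  map_smul' r y := map_smul (Submodule.mapQ J J₂ (LinearMap.mulLeft (DetS 𝕜 m n) s) h) (φ r) y

lemma mulMap_mk (s : DetS 𝕜 m n) (h : ∀ y ∈ J, s * y ∈ J₂) (y : DetS 𝕜 m n) :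
    mulMap φ s h (mk φ y) = mk φ (s * y) := rfl

lemma hom_ext {M : Type} [AddCommGroup M] [Module (DetR 𝕜 m n) M]
    {f g : PhiQuot φ J →ₗ[DetR 𝕜 m n] M} (h : ∀ y, f (mk φ y) = g (mk φ y)) : f = g :=
  LinearMap.ext fun y => by
    obtain ⟨y, rfl⟩ := mk_surjective φ y
    exact h y

/-- The projection `S/J → S/J₂` for `J ≤ J₂`. -/
def proj (h : J ≤ J₂) : PhiQuot φ J →ₗ[DetR 𝕜 m n] PhiQuot φ J₂ :=
  mulMap φ 1 fun y hy => by rw [one_mul]; exact h hy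

lemma proj_mk (h : J ≤ J₂) (y : DetS 𝕜 m n) : proj φ h (mk φ y) = mk φ y := by
  rw [proj, mulMap_mk, one_mul]

lemma proj_surjective (h : J ≤ J₂) : Function.Surjective (proj φ h) := fun y => by
  obtain ⟨y, rfl⟩ := mk_surjective φ y
  exact ⟨mk φ y, proj_mk φ h y⟩

end PhiQuot

end PhiQuot

section CutIdeal

variable {σ : Type} {K : Type} [Field K] [DecidableEq σ]

omit [DecidableEq σ] in
lemma partialDegree_lt_one {T : Finset σ} {d : σ →₀ ℕ} :
    partialDegree T d < 1 ↔ ∀ s ∈ T, d s = 0 := by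
  rw [partialDegree_apply, Nat.lt_one_iff, Finset.sum_eq_zero_iff]

omit [DecidableEq σ] in
lemma coeff_add_single_X_mul (j : σ) (s : MvPowerSeries σ K) (d : σ →₀ ℕ) :
    coeff (d + Finsupp.single j 1) (X j * s) = coeff d s := by
  rw [X, add_comm, coeff_add_monomial_mul, one_mul]

lemma mem_of_X_mul_mem_wtIdeal {T : Finset σ} {j : σ} (hj : j ∉ T) {s : MvPowerSeries σ K}
    (h : X j * s ∈ wtIdeal (partialDegree T) 1) : s ∈ wtIdeal (partialDegree T) 1 := by
  intro d hd
  rw [← coeff_add_single_X_mul j]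
  refine h _ ?_
  rwa [map_add, partialDegree_single, if_neg hj, add_zero]

lemma exists_X_mul_sub_mem_wtIdeal {T : Finset σ} {j : σ} {s : MvPowerSeries σ K}
    (h : s ∈ wtIdeal (partialDegree (insert j T)) 1) :
    ∃ g, X j * g - s ∈ wtIdeal (partialDegree T) 1 := by
  let g : MvPowerSeries σ K := fun e => coeff (e + Finsupp.single j 1) s
  have hg : ∀ e, coeff e g = coeff (e + Finsupp.single j 1) s := fun _ => rfl
  refine ⟨g, fun d hd => ?_⟩
  rw [map_sub, X, coeff_monomial_mul, one_mul]
  split_ifs with hle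
  · rw [hg, tsub_add_cancel_of_le hle, sub_self]
  · rw [zero_sub, neg_eq_zero]
    refine h d ?_
    rw [partialDegree_lt_one] at hd ⊢
    intro s hs
    rcases Finset.mem_insert.1 hs with rfl | hs
    · simpa [Nat.lt_one_iff] using hle
    · exact hd s hs

end CutIdeal

lemma IsExtSelfDual.congr {R : Type} [CommRing R] {ω : ModuleCat.{0} R} {M M' : Type}
    [AddCommGroup M] [Module R M] [AddCommGroup M'] [Module R M'] {e : ℕ}
    (h : IsExtSelfDual ω M e) (f : M ≃ₗ[R] M') : IsExtSelfDual ω M' e where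
  subsingleton i hi := by
    have := h.subsingleton i hi
    exact (extCongr ω f i).toEquiv.subsingleton
  equiv := by
    obtain ⟨g⟩ := h.equiv
    exact ⟨(extCongr ω f e).trans (g.trans f)⟩

section SelfDual

variable {𝕜 : Type} [Field 𝕜] {m n : ℕ} (φ : DetR 𝕜 m n →ₐ[𝕜] DetS 𝕜 m n)
  (hφ : IsDetPhi 𝕜 m n φ)

include hφ

lemma span_mk_one_eq_top (hn : 1 ≤ n) {T : Finset (Fin m ⊕ Fin (n - 1))} (hT : aVars m n ⊆ T) :
    Submodule.span (DetR 𝕜 m n)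
      {(PhiQuot.mk φ 1 : PhiQuot φ (wtIdeal (partialDegree T) 1))} = ⊤ := by
  classical
  rw [eq_top_iff]
  rintro y -
  obtain ⟨s, rfl⟩ := PhiQuot.mk_surjective φ y
  let s₀ : DetS 𝕜 m n := fun d => if adeg m n d = 0 then coeff d s else 0
  have hs₀ : ∀ d, coeff d s₀ = if adeg m n d = 0 then coeff d s else 0 := fun _ => rfl
  obtain ⟨r, hr⟩ := exists_phi_eq φ hφ hn s₀ (fun d hd => by
    rw [hs₀] at hd
    have : adeg m n d = 0 := by
      by_contra h
      exact hd (if_neg h)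
    omega)
  rw [Submodule.mem_span_singleton]
  refine ⟨r, ?_⟩
  rw [PhiQuot.smul_eq, PhiQuot.smul_mk, mul_one, hr, PhiQuot.mk_eq_mk]
  intro d hd
  rw [map_sub, hs₀, if_pos, sub_self]
  rw [← Nat.lt_one_iff, partialDegree_lt_one]
  rw [partialDegree_lt_one] at hd
  exact fun s hs => hd s (hT hs)

lemma finite_phiQuot (hn : 1 ≤ n) {T : Finset (Fin m ⊕ Fin (n - 1))} (hT : aVars m n ⊆ T) :
    Module.Finite (DetR 𝕜 m n) (PhiQuot φ (wtIdeal (partialDegree T) 1)) :=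
  ⟨⟨{_}, by rw [Finset.coe_singleton]; exact span_mk_one_eq_top φ hφ hn hT⟩⟩

lemma residueField_equiv_phiQuot [IsLocalRing (DetR 𝕜 m n)] (hn : 1 ≤ n) :
    Nonempty (IsLocalRing.ResidueField (DetR 𝕜 m n) ≃ₗ[DetR 𝕜 m n]
      PhiQuot φ (wtIdeal (partialDegree Finset.univ) 1)) := by
  classical
  let f : DetR 𝕜 m n →ₗ[DetR 𝕜 m n] PhiQuot φ (wtIdeal (partialDegree Finset.univ) 1) :=
    LinearMap.toSpanSingleton _ _ (PhiQuot.mk φ 1)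
  have hf : ∀ r, f r = PhiQuot.mk φ (φ r) := fun r => by
    rw [LinearMap.toSpanSingleton_apply, PhiQuot.smul_eq, PhiQuot.smul_mk, mul_one]
  have hsurj : Function.Surjective f := by
    rw [← LinearMap.range_eq_top, LinearMap.range_toSpanSingleton]
    exact span_mk_one_eq_top φ hφ hn (Finset.subset_univ _)
  have hker : LinearMap.ker f = IsLocalRing.maximalIdeal (DetR 𝕜 m n) := by
    refine le_antisymm (IsLocalRing.le_maximalIdeal fun h => ?_) fun r hr => ?_
    · have h1 : (1 : DetR 𝕜 m n) ∈ LinearMap.ker f := by rw [h]; trivial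
      rw [LinearMap.mem_ker, hf, map_one, PhiQuot.mk_eq_zero] at h1
      have := h1 0 (by simp)
      simp at this
    · rw [LinearMap.mem_ker, hf, PhiQuot.mk_eq_zero]
      rw [← pow_one (IsLocalRing.maximalIdeal _)] at hr
      intro d hd
      refine phi_mem_of_mem_maximalIdeal_pow φ hφ hr d ?_
      rw [partialDegree_lt_one] at hd ⊢
      exact fun s _ => hd s (Finset.mem_univ s)
  exact ⟨(Submodule.quotEquivOfEq _ _ hker.symm).trans (f.quotKerEquivOfSurjective hsurj)⟩

lemma detx_last_mem_maximalIdeal [IsLocalRing (DetR 𝕜 m n)] (hn : 1 ≤ n) (i : Fin m) :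
    detx 𝕜 m n i ⟨n - 1, by omega⟩ ∈ IsLocalRing.maximalIdeal (DetR 𝕜 m n) := by
  rw [IsLocalRing.mem_maximalIdeal, mem_nonunits_iff]
  intro h
  have h2 := h.map φ
  rw [hφ, dif_neg (by simp), MvPowerSeries.isUnit_iff_constantCoeff] at h2
  simp at h2

lemma isExtSelfDual_phiQuot [IsLocalRing (DetR 𝕜 m n)] (hn : 1 ≤ n)
    (ω : ModuleCat.{0} (DetR 𝕜 m n)) [Module.Finite (DetR 𝕜 m n) ω]
    (h : IsExtSelfDual ω (IsLocalRing.ResidueField (DetR 𝕜 m n)) (m + n - 1)) (k : ℕ)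
    (T : Finset (Fin m ⊕ Fin (n - 1))) (hT : aVars m n ⊆ T) (hk : Tᶜ.card = k) (e : ℕ)
    (he : e + k = m + n - 1) :
    IsExtSelfDual ω (PhiQuot φ (wtIdeal (partialDegree T) 1)) e := by
  classical
  induction k generalizing T e with
  | zero =>
    rw [Finset.card_eq_zero, Finset.compl_eq_empty_iff] at hk
    subst hk
    obtain ⟨g⟩ := residueField_equiv_phiQuot φ hφ hn
    obtain rfl : e = m + n - 1 := by omega
    exact h.congr g
  | succ k ih =>
    obtain ⟨s, hs⟩ : (Tᶜ).Nonempty := Finset.card_pos.1 (by omega)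
    rw [Finset.mem_compl] at hs
    obtain ⟨i, rfl⟩ : ∃ i, s = Sum.inl i := by
      rcases s with i | j
      · exact ⟨i, rfl⟩
      · exact absurd (hT (inr_mem_aVars j)) hs
    have hcard : (insert (Sum.inl i) T)ᶜ.card = k := by
      have h1 := Finset.card_add_card_compl T
      have h2 := Finset.card_add_card_compl (insert (Sum.inl i) T)
      rw [Finset.card_insert_of_notMem hs] at h2
      omega
    have ih' := ih (insert (Sum.inl i) T) (hT.trans (Finset.subset_insert _ _)) hcard (e + 1)
      (by omega)
    have hle : (wtIdeal (partialDegree T) 1 : Ideal (DetS 𝕜 m n)) ≤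
        wtIdeal (partialDegree (insert (Sum.inl i) T)) 1 := by
      intro s hs d hd
      refine hs d ?_
      rw [partialDegree_lt_one] at hd ⊢
      exact fun s hs => hd s (Finset.mem_insert_of_mem hs)
    have hx : φ (detx 𝕜 m n i ⟨n - 1, by omega⟩) = X (Sum.inl i) := by
      rw [hφ, dif_neg (by simp)]
    have := finite_phiQuot φ hφ hn hT
    refine IsExtSelfDual.of_smul_exact ω ih' (detx 𝕜 m n i ⟨n - 1, by omega⟩)
      (detx_last_mem_maximalIdeal φ hφ hn i) ?_ (PhiQuot.proj φ hle)
      (PhiQuot.proj_surjective φ hle) ?_ (PhiQuot.mk φ 1) (span_mk_one_eq_top φ hφ hn hT)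
    · intro y y' hyy
      obtain ⟨y, rfl⟩ := PhiQuot.mk_surjective φ y
      obtain ⟨y', rfl⟩ := PhiQuot.mk_surjective φ y'
      simp only [PhiQuot.smul_eq, hx, PhiQuot.smul_mk, PhiQuot.mk_eq_mk, ← mul_sub] at hyy ⊢
      exact mem_of_X_mul_mem_wtIdeal hs hyy
    · intro y
      obtain ⟨y, rfl⟩ := PhiQuot.mk_surjective φ y
      rw [PhiQuot.proj_mk, PhiQuot.mk_eq_zero]
      constructor
      · intro hy
        obtain ⟨g, hg⟩ := exists_X_mul_sub_mem_wtIdeal hy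
        exact ⟨PhiQuot.mk φ g, by
          rwa [PhiQuot.smul_eq, hx, PhiQuot.smul_mk, PhiQuot.mk_eq_mk]⟩
      · rintro ⟨z, hz⟩
        obtain ⟨z, rfl⟩ := PhiQuot.mk_surjective φ z
        rw [PhiQuot.smul_eq, hx, PhiQuot.smul_mk, PhiQuot.mk_eq_mk] at hz
        have h1 : X (Sum.inl i) * z ∈ wtIdeal (partialDegree (insert (Sum.inl i) T)) 1 := by
          refine Ideal.mul_mem_right _ _ (X_mem_wtIdeal ?_)
          rw [partialDegree_single, if_pos (Finset.mem_insert_self _ _)]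
        have h2 := sub_mem h1 (hle hz)
        rwa [sub_sub_cancel] at h2

/-- The module `S/(a_1, …, a_{n-1})` is self-dual. -/
lemma isExtSelfDual_phiQuot_aVars [IsLocalRing (DetR 𝕜 m n)] (hn : 1 ≤ n)
    (ω : ModuleCat.{0} (DetR 𝕜 m n)) [Module.Finite (DetR 𝕜 m n) ω]
    (h : IsExtSelfDual ω (IsLocalRing.ResidueField (DetR 𝕜 m n)) (m + n - 1)) :
    IsExtSelfDual ω (PhiQuot φ (wtIdeal (adeg m n) 1)) (n - 1) := by
  classical
  refine isExtSelfDual_phiQuot φ hφ hn ω h m (aVars m n) subset_rfl ?_ (n - 1) (by omega)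
  have : (aVars m n)ᶜ = Finset.univ.map (Function.Embedding.inl) := by
    ext s
    rcases s with i | j <;> simp [aVars]
  rw [this, Finset.card_map, Finset.card_univ, Fintype.card_fin]

end SelfDual

section GradedPieces

variable {σ : Type} {K : Type} [Field K] [DecidableEq σ]

lemma partialDegree_of_mem_finsuppAntidiag {T : Finset σ} {t : ℕ} {α : σ →₀ ℕ}
    (h : α ∈ T.finsuppAntidiag t) : partialDegree T α = t := (Finset.mem_finsuppAntidiag.1 h).1

lemma monomial_mul_mem_wtIdeal {T : Finset σ} {t k : ℕ} {α : σ →₀ ℕ}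
    (h : α ∈ T.finsuppAntidiag t) {y : MvPowerSeries σ K}
    (hy : y ∈ wtIdeal (partialDegree T) k) :
    monomial α 1 * y ∈ wtIdeal (partialDegree T) (t + k) :=
  mul_mem_wtIdeal (monomial_mem_wtIdeal (partialDegree_of_mem_finsuppAntidiag h).ge 1) hy

lemma exists_eq_sum_monomial {T : Finset σ} {t : ℕ} {s : MvPowerSeries σ K}
    (hs : s ∈ wtIdeal (partialDegree T) t) :
    ∃ c : (σ →₀ ℕ) → MvPowerSeries σ K, ∑ α ∈ T.finsuppAntidiag t, monomial α 1 * c α = s := by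
  have h := mem_span_monomial (T.finsuppAntidiag t) s fun e he =>
    exists_le_finsuppAntidiag T t e (by
      by_contra! hlt
      exact he (hs e hlt))
  obtain ⟨c, hc⟩ := (Submodule.mem_span_image_finset_iff_exists_fun' _).1 h
  refine ⟨c, ?_⟩
  rw [← hc]
  exact Finset.sum_congr rfl fun α _ => mul_comm _ _

lemma coeff_add_monomial_mul_of_mem {T : Finset σ} {t : ℕ} {α β d : σ →₀ ℕ}
    (hα : α ∈ T.finsuppAntidiag t) (hβ : β ∈ T.finsuppAntidiag t)
    (hd : partialDegree T d < 1) (y : MvPowerSeries σ K) :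
    coeff (α + d) (monomial β 1 * y) = if β = α then coeff d y else 0 := by
  split_ifs with h
  · subst h
    rw [coeff_add_monomial_mul, one_mul]
  · rw [coeff_monomial_mul, if_neg]
    intro hle
    refine h ?_
    rw [partialDegree_lt_one] at hd
    have hβα : ∀ s ∈ T, β s ≤ α s := fun s hs => by
      have := hle s
      rwa [Finsupp.add_apply, hd s hs, add_zero] at this
    have hsum : ∑ s ∈ T, β s = ∑ s ∈ T, α s :=
      (partialDegree_of_mem_finsuppAntidiag hβ).trans
        (partialDegree_of_mem_finsuppAntidiag hα).symm
    ext s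
    by_cases hs : s ∈ T
    · exact (Finset.sum_eq_sum_iff_of_le hβα).1 hsum s hs
    · rw [Finsupp.notMem_support_iff.1 fun h => hs ((Finset.mem_finsuppAntidiag.1 hα).2 h),
        Finsupp.notMem_support_iff.1 fun h => hs ((Finset.mem_finsuppAntidiag.1 hβ).2 h)]

lemma mem_of_sum_monomial_mem {T : Finset σ} {t : ℕ} (c : (σ →₀ ℕ) → MvPowerSeries σ K)
    (h : ∑ β ∈ T.finsuppAntidiag t, monomial β 1 * c β ∈ wtIdeal (partialDegree T) (t + 1))
    {α : σ →₀ ℕ} (hα : α ∈ T.finsuppAntidiag t) : c α ∈ wtIdeal (partialDegree T) 1 := by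
  intro d hd
  have h1 := h (α + d) (by
    rw [map_add, partialDegree_of_mem_finsuppAntidiag hα]
    omega)
  rw [map_sum, Finset.sum_congr rfl fun β hβ => coeff_add_monomial_mul_of_mem hα hβ hd (c β),
    Finset.sum_ite_eq', if_pos hα] at h1
  exact h1

end GradedPieces

section PiExt

variable {R : Type} [CommRing R] (ω : ModuleCat.{0} R) {M : Type} [AddCommGroup M] [Module R M]
  {ι : Type} [Fintype ι] [DecidableEq ι]

lemma sum_extMap_proj_single (i : ℕ) (x : ExtMod ω (ι → M) i) :
    ∑ j, extMap ω (LinearMap.proj j : (ι → M) →ₗ[R] M) i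
      (extMap ω (LinearMap.single R (fun _ => M) j) i x) = x := by
  simp_rw [extMap_comp_apply]
  rw [← LinearMap.sum_apply, ← extMap_sum]
  have : ∑ j, (LinearMap.single R (fun _ : ι => M) j) ∘ₗ (LinearMap.proj j) = LinearMap.id := by
    ext y k
    simp [Finset.sum_apply, Pi.single_apply]
  rw [this, extMap_id]
  rfl

omit [Fintype ι] in
lemma extMap_single_proj (i : ℕ) (j k : ι) (x : ExtMod ω M i) :
    extMap ω (LinearMap.single R (fun _ => M) j) i
      (extMap ω (LinearMap.proj k : (ι → M) →ₗ[R] M) i x) = if j = k then x else 0 := by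
  rw [extMap_comp_apply]
  split_ifs with h
  · subst h
    rw [LinearMap.proj_comp_single_same, extMap_id]
    rfl
  · rw [LinearMap.proj_comp_single_ne R _ k j (Ne.symm h), extMap_zero]
    rfl

lemma subsingleton_extMod_pi (i : ℕ) (h : Subsingleton (ExtMod ω M i)) :
    Subsingleton (ExtMod ω (ι → M) i) := by
  refine subsingleton_of_forall_eq 0 fun x => ?_
  rw [← sum_extMap_proj_single ω i x]
  refine Finset.sum_eq_zero fun j _ => ?_
  rw [Subsingleton.elim (extMap ω (LinearMap.single R (fun _ => M) j) i x) 0, map_zero]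

lemma subsingleton_extMod_of_subsingleton [Subsingleton M] (i : ℕ) :
    Subsingleton (ExtMod ω M i) := by
  refine subsingleton_of_forall_eq 0 fun x => ?_
  have h : (LinearMap.id : M →ₗ[R] M) = 0 := LinearMap.ext fun _ => Subsingleton.elim _ _
  rw [← LinearMap.id_apply (R := R) x, ← extMap_id, h, extMap_zero]
  rfl

end PiExt

section PhiPow

/-- The exponents of the monomials of degree `t` in the `a_j`. -/
abbrev aExps (m n t : ℕ) : Finset (Fin m ⊕ Fin (n - 1) →₀ ℕ) := (aVars m n).finsuppAntidiag t

variable {𝕜 : Type} [Field 𝕜] {m n : ℕ} (φ : DetR 𝕜 m n →ₐ[𝕜] DetS 𝕜 m n)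

/-- The module `S/(a_1, …, a_{n-1})^t` over `R`. -/
abbrev PhiPow (t : ℕ) : Type := PhiQuot φ (wtIdeal (adeg m n) t)

lemma PhiQuot.mk_sum {J : Ideal (DetS 𝕜 m n)} {ι : Type} (s : Finset ι) (f : ι → DetS 𝕜 m n) :
    (PhiQuot.mk φ (∑ i ∈ s, f i) : PhiQuot φ J) = ∑ i ∈ s, PhiQuot.mk φ (f i) :=
  map_sum (AddMonoidHom.mk' (PhiQuot.mk φ : DetS 𝕜 m n → PhiQuot φ J) (PhiQuot.mk_add φ)) f s

namespace PhiPow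

/-- Multiplication by a power series on `S/(a_1, …, a_{n-1})^t`. -/
def smulMap (t : ℕ) (s : DetS 𝕜 m n) : PhiPow φ t →ₗ[DetR 𝕜 m n] PhiPow φ t :=
  PhiQuot.mulMap φ s fun _ hy => Ideal.mul_mem_left _ s hy

/-- The projection onto a quotient by a smaller power. -/
def proj {t u : ℕ} (h : t ≤ u) : PhiPow φ u →ₗ[DetR 𝕜 m n] PhiPow φ t :=
  PhiQuot.proj φ (wtIdeal_mono _ h)

lemma proj_mk {t u : ℕ} (h : t ≤ u) (s : DetS 𝕜 m n) :
    proj φ h (PhiQuot.mk φ s) = PhiQuot.mk φ s := PhiQuot.proj_mk φ _ s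

lemma proj_surjective {t u : ℕ} (h : t ≤ u) : Function.Surjective (proj φ h) :=
  PhiQuot.proj_surjective φ _

lemma smulMap_mk (t : ℕ) (s y : DetS 𝕜 m n) :
    smulMap φ t s (PhiQuot.mk φ y) = PhiQuot.mk φ (s * y) := rfl

lemma smulMap_comp_proj {t u : ℕ} (h : t ≤ u) (s : DetS 𝕜 m n) :
    smulMap φ t s ∘ₗ proj φ h = proj φ h ∘ₗ smulMap φ u s :=
  PhiQuot.hom_ext φ fun y => by
    rw [LinearMap.comp_apply, LinearMap.comp_apply, proj_mk, smulMap_mk, smulMap_mk, proj_mk]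

/-- Multiplication by a monomial of degree `t`. -/
def monMap {t : ℕ} (α : aExps m n t) : PhiPow φ 1 →ₗ[DetR 𝕜 m n] PhiPow φ (t + 1) :=
  PhiQuot.mulMap φ (monomial (α : Fin m ⊕ Fin (n - 1) →₀ ℕ) 1) fun _ hy =>
    monomial_mul_mem_wtIdeal α.2 hy

lemma monMap_mk {t : ℕ} (α : aExps m n t) (y : DetS 𝕜 m n) :
    monMap φ α (PhiQuot.mk φ y) = PhiQuot.mk φ (monomial (α : _ →₀ ℕ) 1 * y) := rfl

lemma monMap_comp_proj {t : ℕ} (α : aExps m n t) :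
    monMap φ α ∘ₗ proj φ (Nat.le_add_left 1 t) =
      smulMap φ (t + 1) (monomial (α : _ →₀ ℕ) 1) :=
  PhiQuot.hom_ext φ fun y => by
    rw [LinearMap.comp_apply, proj_mk, smulMap_mk, monMap_mk]

/-- The inclusion of the kernel of `S/(a)^{t+1} → S/(a)^t`. -/
def gradedMap (t : ℕ) : (aExps m n t → PhiPow φ 1) →ₗ[DetR 𝕜 m n] PhiPow φ (t + 1) :=
  ∑ α, monMap φ α ∘ₗ LinearMap.proj α

lemma gradedMap_mk (t : ℕ) (c : (Fin m ⊕ Fin (n - 1) →₀ ℕ) → DetS 𝕜 m n) :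
    gradedMap φ t (fun α : aExps m n t => PhiQuot.mk φ (c α)) =
      PhiQuot.mk φ (∑ α ∈ aExps m n t, monomial α 1 * c α) := by
  rw [gradedMap, LinearMap.sum_apply]
  simp only [LinearMap.comp_apply, LinearMap.proj_apply, monMap_mk]
  rw [PhiQuot.mk_sum]
  exact Finset.sum_coe_sort (aExps m n t) fun α => PhiQuot.mk φ (monomial α 1 * c α)

lemma gradedMap_comp_single (t : ℕ) (α : aExps m n t) :
    gradedMap φ t ∘ₗ LinearMap.single (DetR 𝕜 m n) (fun _ => PhiPow φ 1) α = monMap φ α := by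
  classical
  ext y
  rw [gradedMap, LinearMap.comp_apply, LinearMap.sum_apply, Finset.sum_eq_single α]
  · simp
  · intro β _ hβ
    simp [hβ]
  · simp

lemma exists_mk_eq {t : ℕ} (y : aExps m n t → PhiPow φ 1) :
    ∃ c : (Fin m ⊕ Fin (n - 1) →₀ ℕ) → DetS 𝕜 m n, y = fun α : aExps m n t => PhiQuot.mk φ (c α) := by
  classical
  choose c hc using fun α => PhiQuot.mk_surjective φ (y α)
  refine ⟨fun α => if h : α ∈ aExps m n t then c ⟨α, h⟩ else 0, ?_⟩
  funext α
  simp only [dif_pos α.2, hc]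

lemma gradedMap_injective (t : ℕ) : Function.Injective (gradedMap φ t) := by
  rw [injective_iff_map_eq_zero]
  intro y hy
  obtain ⟨c, rfl⟩ := exists_mk_eq φ y
  rw [gradedMap_mk, PhiQuot.mk_eq_zero] at hy
  funext α
  exact (PhiQuot.mk_eq_zero φ).2 (mem_of_sum_monomial_mem c hy α.2)

lemma gradedMap_exact (t : ℕ) :
    Function.Exact (gradedMap φ t) (proj φ (Nat.le_succ t)) := by
  intro y
  constructor
  · intro hy
    obtain ⟨s, rfl⟩ := PhiQuot.mk_surjective φ y
    rw [proj_mk, PhiQuot.mk_eq_zero] at hy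
    obtain ⟨c, hc⟩ := exists_eq_sum_monomial hy
    exact ⟨_, (gradedMap_mk φ t c).trans (by rw [hc])⟩
  · rintro ⟨y, rfl⟩
    obtain ⟨c, rfl⟩ := exists_mk_eq φ y
    rw [gradedMap_mk, proj_mk, PhiQuot.mk_eq_zero]
    refine Ideal.sum_mem _ fun α hα => Ideal.mul_mem_right _ _ (monomial_mem_wtIdeal ?_ 1)
    exact (partialDegree_of_mem_finsuppAntidiag hα).ge

instance : Subsingleton (PhiPow φ 0) := by
  refine subsingleton_of_forall_eq 0 fun y => ?_
  obtain ⟨s, rfl⟩ := PhiQuot.mk_surjective φ y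
  rw [PhiQuot.mk_eq_zero, wtIdeal_zero]
  trivial

section Finite

variable (hφ : IsDetPhi 𝕜 m n φ) (hn : 1 ≤ n)

include hφ hn

lemma finite (t : ℕ) : Module.Finite (DetR 𝕜 m n) (PhiPow φ t) := by
  induction t with
  | zero => infer_instance
  | succ t ih =>
    have : Module.Finite (DetR 𝕜 m n) (PhiPow φ 1) := finite_phiQuot φ hφ hn subset_rfl
    exact .of_exact (gradedMap_exact φ t) (proj_surjective φ _)

end Finite

section Ext

variable (ω : ModuleCat.{0} (DetR 𝕜 m n)) {c : ℕ} (h : IsExtSelfDual ω (PhiPow φ 1) c)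

include h

lemma subsingleton_extMod (t i : ℕ) (hi : i ≠ c) : Subsingleton (ExtMod ω (PhiPow φ t) i) := by
  induction t with
  | zero => exact subsingleton_extMod_of_subsingleton ω i
  | succ t ih =>
    exact subsingleton_extMod_of_exact ω (gradedMap_injective φ t) (gradedMap_exact φ t)
      (proj_surjective φ _) i (subsingleton_extMod_pi ω i (h.subsingleton i hi)) ih

lemma extMap_proj_succ_injective (t : ℕ) :
    Function.Injective (extMap ω (proj φ (Nat.le_succ t)) c) :=
  extMap_injective_of_subsingleton ω (gradedMap_injective φ t) (gradedMap_exact φ t)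
    (proj_surjective φ _) c fun j hj =>
      subsingleton_extMod_pi ω j (h.subsingleton j (by omega))

omit h in
lemma proj_comp_proj {t u v : ℕ} (h : t ≤ u) (h' : u ≤ v) :
    proj φ h ∘ₗ proj φ h' = proj φ (h.trans h') :=
  PhiQuot.hom_ext φ fun y => by
    rw [LinearMap.comp_apply, proj_mk, proj_mk, proj_mk]

omit h in
lemma proj_self (t : ℕ) : proj φ (le_refl t) = LinearMap.id :=
  PhiQuot.hom_ext φ fun y => by
    rw [proj_mk, LinearMap.id_apply]

lemma extMap_proj_injective {t u : ℕ} (htu : t ≤ u) :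
    Function.Injective (extMap ω (proj φ htu) c) := by
  induction u, htu using Nat.le_induction with
  | base => rw [proj_self, extMap_id]; exact Function.injective_id
  | succ u htu ih =>
    rw [← proj_comp_proj φ htu (Nat.le_succ u), extMap_comp]
    exact (extMap_proj_succ_injective φ ω h u).comp ih

/-- Elements of `Ext(S/(a)^{t+1}, ω)` with prescribed products with the monomials of
degree `t`. -/
lemma exists_extMap_monMap_eq (t : ℕ) (u : aExps m n t → ExtMod ω (PhiPow φ 1) c) :
    ∃ x : ExtMod ω (PhiPow φ (t + 1)) c, ∀ α, extMap ω (monMap φ α) c x = u α := by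
  classical
  obtain ⟨x, hx⟩ := extMap_surjective_of_subsingleton ω (gradedMap_injective φ t)
    (gradedMap_exact φ t) (proj_surjective φ _) c
    (subsingleton_extMod φ ω h t (c + 1) (Nat.succ_ne_self c))
    (∑ α, extMap ω (LinearMap.proj α) c (u α))
  refine ⟨x, fun α => ?_⟩
  rw [← gradedMap_comp_single, ← extMap_comp_apply, hx, map_sum]
  simp_rw [extMap_single_proj]
  rw [Finset.sum_ite_eq, if_pos (Finset.mem_univ α)]

omit h in
lemma mem_range_extMap_proj (t : ℕ) (x : ExtMod ω (PhiPow φ (t + 1)) c)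
    (hx : ∀ α : aExps m n t, extMap ω (monMap φ α) c x = 0) :
    ∃ y, extMap ω (proj φ (Nat.le_succ t)) c y = x := by
  classical
  refine (extMap_exact ω (gradedMap_injective φ t) (gradedMap_exact φ t)
    (proj_surjective φ _) c x).1 ?_
  rw [← sum_extMap_proj_single ω c (extMap ω (gradedMap φ t) c x)]
  refine Finset.sum_eq_zero fun α _ => ?_
  rw [extMap_comp_apply ω _ (gradedMap φ t), gradedMap_comp_single, hx, map_zero]

end Ext

end PhiPow

end PhiPow

section PowFiltration

variable {𝕜 : Type} [Field 𝕜] {m n : ℕ} (φ : DetR 𝕜 m n →ₐ[𝕜] DetS 𝕜 m n)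
  {H : Type} [AddCommGroup H] [Module (DetR 𝕜 m n) H] [Module (DetS 𝕜 m n) H]

/-- The properties of the filtration of the top local cohomology of `ω` by the submodules
`Ext(S/(a_1, …, a_{n-1})^t, ω)`, and of a generator `e` of its first step. -/
structure IsPowFiltration (W : ℕ → Submodule (DetS 𝕜 m n) H) (e : H) : Prop where
  phi_smul : ∀ (r : DetR 𝕜 m n) (h : H), φ r • h = r • h
  zero : ∀ h ∈ W 0, h = 0
  mono : Monotone W
  exhaustive : ∀ h, ∃ t, h ∈ W t
  smul_eq_zero : ∀ t, ∀ s ∈ (wtIdeal (adeg m n) t : Ideal (DetS 𝕜 m n)), ∀ h ∈ W t, s • h = 0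
  mem_of_smul_eq_zero : ∀ t, ∀ h ∈ W (t + 1),
    (∀ α ∈ aExps m n t, (monomial α 1 : DetS 𝕜 m n) • h = 0) → h ∈ W t
  exists_dual : ∀ t, ∀ α ∈ aExps m n t, ∃ w ∈ W (t + 1), ∀ β ∈ aExps m n t,
    (monomial β 1 : DetS 𝕜 m n) • w = if β = α then e else 0
  gen_mem : e ∈ W 1
  exists_smul_gen : ∀ h ∈ W 1, ∃ s : DetS 𝕜 m n, s • e = h
  of_smul_gen_eq_zero : ∀ s : DetS 𝕜 m n, s • e = 0 → s ∈ wtIdeal (adeg m n) 1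

namespace IsPowFiltration

variable {φ} {W : ℕ → Submodule (DetS 𝕜 m n) H} {e : H} (hW : IsPowFiltration φ W e)

include hW

lemma mem_of_forall_smul_eq_zero (t : ℕ) (h : H)
    (hh : ∀ s ∈ (wtIdeal (adeg m n) t : Ideal (DetS 𝕜 m n)), s • h = 0) : h ∈ W t := by
  have key : ∀ k, h ∈ W (t + k) → h ∈ W t := by
    intro k
    induction k with
    | zero => exact id
    | succ k ih =>
      intro hk
      refine ih (hW.mem_of_smul_eq_zero (t + k) h hk fun α hα => hh _ (monomial_mem_wtIdeal ?_ 1))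
      rw [partialDegree_of_mem_finsuppAntidiag hα]
      omega
  obtain ⟨u, hu⟩ := hW.exhaustive h
  exact key u (hW.mono (Nat.le_add_left u t) hu)

lemma smul_mem_one {t : ℕ} {α : Fin m ⊕ Fin (n - 1) →₀ ℕ} (hα : α ∈ aExps m n t) {h : H}
    (hh : h ∈ W (t + 1)) : (monomial α 1 : DetS 𝕜 m n) • h ∈ W 1 := by
  refine hW.mem_of_forall_smul_eq_zero 1 _ fun s hs => ?_
  rw [smul_smul, mul_comm]
  exact hW.smul_eq_zero (t + 1) _ (monomial_mul_mem_wtIdeal hα hs) h hh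

lemma eq_zero_of_X_smul (i : Fin m) {h : H}
    (hh : (X (Sum.inl i) : DetS 𝕜 m n) • h = 0) : h = 0 := by
  have key : ∀ t, h ∈ W t → h = 0 := by
    intro t
    induction t with
    | zero => exact hW.zero h
    | succ t ih =>
      intro ht
      refine ih (hW.mem_of_smul_eq_zero t h ht fun α hα => ?_)
      obtain ⟨s, hs⟩ := hW.exists_smul_gen _ (hW.smul_mem_one hα ht)
      have h1 : (X (Sum.inl i) * s) • e = 0 := by
        rw [mul_smul, hs, smul_comm, hh, smul_zero]
      have h2 := mem_of_X_mul_mem_wtIdeal (inl_notMem_aVars i) (hW.of_smul_gen_eq_zero _ h1)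
      rw [← hs]
      exact hW.smul_eq_zero 1 s h2 e hW.gen_mem
  obtain ⟨t, ht⟩ := hW.exhaustive h
  exact key t ht

lemma eq_zero_of_forall_smul_eq_zero {s : DetS 𝕜 m n} (hs : ∀ h : H, s • h = 0) : s = 0 := by
  have key : ∀ t, s ∈ wtIdeal (adeg m n) t := by
    intro t
    induction t with
    | zero => rw [wtIdeal_zero]; trivial
    | succ t ih =>
      obtain ⟨c, rfl⟩ := exists_eq_sum_monomial ih
      refine Ideal.sum_mem _ fun α hα => monomial_mul_mem_wtIdeal hα ?_
      refine hW.of_smul_gen_eq_zero _ ?_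
      obtain ⟨w, -, hw⟩ := hW.exists_dual t α hα
      have h1 := hs w
      rw [Finset.sum_smul, Finset.sum_eq_single_of_mem α hα] at h1
      · rwa [mul_comm, mul_smul, hw α hα, if_pos rfl] at h1
      · intro β hβ hne
        rw [mul_comm, mul_smul, hw β hβ, if_neg hne, smul_zero]
  ext d
  rw [map_zero]
  exact key (adeg m n d + 1) d (Nat.lt_succ_self _)

variable (hφ : IsDetPhi 𝕜 m n φ) (hm : 1 ≤ m) (hn : 1 ≤ n)

include hφ hm hn

lemma map_smul_end (f : Module.End (DetR 𝕜 m n) H) (s : DetS 𝕜 m n) (h : H) :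
    f (s • h) = s • f h := by
  classical
  obtain ⟨t, ht⟩ := hW.exhaustive h
  obtain ⟨u, hu⟩ := hW.exhaustive (f h)
  set v := max t u
  have ht' := hW.mono (le_max_left t u) ht
  have hu' := hW.mono (le_max_right t u) hu
  let s₀ : DetS 𝕜 m n := fun d => if adeg m n d < v then coeff d s else 0
  have hs₀ : ∀ d, coeff d s₀ = if adeg m n d < v then coeff d s else 0 := fun _ => rfl
  have hsub : s - s₀ ∈ wtIdeal (adeg m n) v := by
    intro d hd
    rw [map_sub, hs₀, if_pos hd, sub_self]
  have hred : ∀ y ∈ W v, s • y = s₀ • y := fun y hy => by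
    rw [← sub_eq_zero, ← sub_smul]
    exact hW.smul_eq_zero v _ hsub y hy
  let i : Fin m := ⟨0, hm⟩
  obtain ⟨r, hr⟩ := exists_phi_eq φ hφ hn (X (Sum.inl i) ^ v * s₀) (fun d hd => by
    rw [X_pow_eq, coeff_monomial_mul, one_mul] at hd
    split_ifs at hd with hle
    · rw [hs₀] at hd
      have h1 : adeg m n (d - Finsupp.single (Sum.inl i) v) < v := by
        by_contra h
        exact hd (if_neg h)
      rw [← tsub_add_cancel_of_le hle, map_add, map_add, partialDegree_single,
        partialDegree_single, if_neg (inl_notMem_aVars i), if_pos (inl_mem_xVars i)]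
      omega
    · exact absurd rfl hd)
  have hx : ∀ k (y : H), (X (Sum.inl i) ^ k : DetS 𝕜 m n) • y = 0 → y = 0 := by
    intro k
    induction k with
    | zero => intro y hy; rwa [pow_zero, one_smul] at hy
    | succ k ih =>
      intro y hy
      rw [pow_succ, mul_smul] at hy
      exact hW.eq_zero_of_X_smul i (ih _ hy)
  have hxφ : ∃ r' : DetR 𝕜 m n, φ r' = X (Sum.inl i) ^ v := by
    refine ⟨detx 𝕜 m n i ⟨n - 1, by omega⟩ ^ v, ?_⟩
    rw [map_pow, hφ, dif_neg (by simp)]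
  obtain ⟨r', hr'⟩ := hxφ
  rw [hred h ht', hred (f h) hu', ← sub_eq_zero]
  refine hx v _ ?_
  rw [smul_sub, sub_eq_zero, smul_smul, ← hr', hW.phi_smul, ← map_smul, ← hW.phi_smul, hr',
    smul_smul, ← hr, hW.phi_smul, hW.phi_smul, map_smul]

omit hφ hm hn in
lemma exists_smul_eq_succ (g : H →+ H) (hg : ∀ (s : DetS 𝕜 m n) h, g (s • h) = s • g h) (t : ℕ)
    (hgt : ∀ h ∈ W t, g h = 0) :
    ∃ s ∈ (wtIdeal (adeg m n) t : Ideal (DetS 𝕜 m n)), ∀ h ∈ W (t + 1), g h = s • h := by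
  classical
  choose! w hwW hw using hW.exists_dual t
  have hgw : ∀ α ∈ aExps m n t, g (w α) ∈ W 1 := by
    intro α hα
    refine hW.mem_of_forall_smul_eq_zero 1 _ fun s hs => ?_
    rw [← hg]
    refine hgt _ (hW.mem_of_smul_eq_zero t _ (Submodule.smul_mem _ _ (hwW α hα)) fun β hβ => ?_)
    rw [smul_smul]
    exact hW.smul_eq_zero (t + 1) _ (monomial_mul_mem_wtIdeal hβ hs) _ (hwW α hα)
  choose! c hc using fun α hα => hW.exists_smul_gen _ (hgw α hα)
  refine ⟨∑ α ∈ aExps m n t, monomial α 1 * c α, Ideal.sum_mem _ fun α hα =>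
    Ideal.mul_mem_right _ _ (monomial_mem_wtIdeal
      (partialDegree_of_mem_finsuppAntidiag hα).ge 1), fun h hh => ?_⟩
  choose! b hb using fun α hα => hW.exists_smul_gen _ (hW.smul_mem_one (α := α) hα hh)
  have hmem : h - ∑ α ∈ aExps m n t, b α • w α ∈ W t := by
    refine hW.mem_of_smul_eq_zero t _ (sub_mem hh (Submodule.sum_mem _ fun α hα =>
      Submodule.smul_mem _ _ (hwW α hα))) fun β hβ => ?_
    rw [smul_sub, sub_eq_zero, ← hb β hβ, Finset.smul_sum, Finset.sum_eq_single_of_mem β hβ]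
    · rw [smul_comm, hw β hβ β hβ, if_pos rfl]
    · intro α hα hne
      rw [smul_comm, hw α hα β hβ, if_neg hne.symm, smul_zero]
  have h1 := hgt _ hmem
  rw [map_sub, sub_eq_zero] at h1
  rw [h1, map_sum, Finset.sum_smul]
  refine Finset.sum_congr rfl fun α hα => ?_
  rw [hg, ← hc α hα, mul_comm, mul_smul, ← hb α hα, smul_comm]

lemma exists_forall_smul_eq (f : Module.End (DetR 𝕜 m n) H) :
    ∃ s : DetS 𝕜 m n, ∀ h, f h = s • h := by
  have hf := hW.map_smul_end hφ hm hn f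
  have step : ∀ t (s : DetS 𝕜 m n), (∀ h ∈ W t, f h = s • h) →
      ∃ s', s' - s ∈ wtIdeal (adeg m n) t ∧ ∀ h ∈ W (t + 1), f h = s' • h := by
    intro t s hs
    let g : H →+ H := f.toAddMonoidHom - DistribSMul.toAddMonoidHom H s
    have hgdef : ∀ h, g h = f h - s • h := fun _ => rfl
    obtain ⟨s', hs', h'⟩ := hW.exists_smul_eq_succ g
      (fun s' h => by rw [hgdef, hgdef, hf, smul_sub, smul_comm s s']) t
      (fun h hh => by rw [hgdef, hs h hh, sub_self])
    refine ⟨s + s', by rwa [add_sub_cancel_left], fun h hh => ?_⟩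
    rw [add_smul, ← h' h hh, hgdef, add_sub_cancel]
  let seq : (t : ℕ) → {s : DetS 𝕜 m n // ∀ h ∈ W t, f h = s • h} := fun t =>
    Nat.rec ⟨0, fun h hh => by rw [hW.zero h hh, map_zero, smul_zero]⟩
      (fun t s => ⟨(step t s.1 s.2).choose, (step t s.1 s.2).choose_spec.2⟩) t
  have hsucc : ∀ t, (seq (t + 1)).1 - (seq t).1 ∈ wtIdeal (adeg m n) t := fun t =>
    (step t (seq t).1 (seq t).2).choose_spec.1
  have hcauchy : ∀ t k, (seq (t + k)).1 - (seq t).1 ∈ wtIdeal (adeg m n) t := by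
    intro t k
    induction k with
    | zero => rw [add_zero, sub_self]; exact zero_mem _
    | succ k ih =>
      have := add_mem (wtIdeal_mono _ (Nat.le_add_right t k) (hsucc (t + k))) ih
      rwa [sub_add_sub_cancel] at this
  let s : DetS 𝕜 m n := fun d => coeff d (seq (adeg m n d + 1)).1
  have hs : ∀ d, coeff d s = coeff d (seq (adeg m n d + 1)).1 := fun _ => rfl
  have hlim : ∀ t, s - (seq t).1 ∈ wtIdeal (adeg m n) t := by
    intro t d hd
    obtain ⟨k, rfl⟩ := Nat.exists_eq_add_of_le (Nat.succ_le_of_lt hd)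
    have := hcauchy (adeg m n d + 1) k d (Nat.lt_succ_self _)
    rw [map_sub, sub_eq_zero] at this
    rw [map_sub, hs, ← this, sub_self]
  refine ⟨s, fun h => ?_⟩
  obtain ⟨t, ht⟩ := hW.exhaustive h
  rw [(seq t).2 h ht, eq_comm, ← sub_eq_zero, ← sub_smul]
  exact hW.smul_eq_zero t _ (hlim t) h ht

end IsPowFiltration

end PowFiltration

section ExtUnion

open PhiPow

variable {𝕜 : Type} [Field 𝕜] {m n : ℕ} (φ : DetR 𝕜 m n →ₐ[𝕜] DetS 𝕜 m n)
  (ω : ModuleCat.{0} (DetR 𝕜 m n)) (c : ℕ) {H : Type} [AddCommGroup H] [Module (DetR 𝕜 m n) H]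

/-- `H` is the union of the modules `Ext(S/(a_1, …, a_{n-1})^t, ω)`. -/
structure IsExtUnion (ι : ∀ t, ExtMod ω (PhiPow φ t) c →ₗ[DetR 𝕜 m n] H) : Prop where
  map_succ : ∀ t x, ι (t + 1) (extMap ω (proj φ (Nat.le_succ t)) c x) = ι t x
  injective : ∀ t, Function.Injective (ι t)
  exists_eq : ∀ h, ∃ t x, ι t x = h

variable {φ ω c} {ι : ∀ t, ExtMod ω (PhiPow φ t) c →ₗ[DetR 𝕜 m n] H}

namespace PhiPow

lemma smulMap_add (t : ℕ) (s s' : DetS 𝕜 m n) :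
    smulMap φ t (s + s') = smulMap φ t s + smulMap φ t s' :=
  PhiQuot.hom_ext φ fun y => by
    rw [LinearMap.add_apply, smulMap_mk, smulMap_mk, smulMap_mk, ← PhiQuot.mk_add, add_mul]

lemma smulMap_mul (t : ℕ) (s s' : DetS 𝕜 m n) :
    smulMap φ t (s * s') = smulMap φ t s' ∘ₗ smulMap φ t s :=
  PhiQuot.hom_ext φ fun y => by
    rw [LinearMap.comp_apply, smulMap_mk, smulMap_mk, smulMap_mk, mul_left_comm, mul_assoc,
      mul_left_comm]

lemma smulMap_phi (t : ℕ) (r : DetR 𝕜 m n) :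
    smulMap φ t (φ r) = r • LinearMap.id :=
  PhiQuot.hom_ext φ fun y => by
    rw [smulMap_mk, LinearMap.smul_apply, LinearMap.id_apply, PhiQuot.smul_eq, PhiQuot.smul_mk]

lemma smulMap_eq_zero {t : ℕ} {s : DetS 𝕜 m n} (hs : s ∈ wtIdeal (adeg m n) t) :
    smulMap φ t s = 0 :=
  PhiQuot.hom_ext φ fun y => by
    rw [smulMap_mk, LinearMap.zero_apply, PhiQuot.mk_eq_zero]
    exact Ideal.mul_mem_right _ _ hs

end PhiPow

namespace IsExtUnion

variable (hι : IsExtUnion φ ω c ι)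

include hι

lemma map_proj {t u : ℕ} (htu : t ≤ u) (x : ExtMod ω (PhiPow φ t) c) :
    ι u (extMap ω (proj φ htu) c x) = ι t x := by
  induction u, htu using Nat.le_induction with
  | base => rw [proj_self, extMap_id]; rfl
  | succ u htu ih =>
    rw [← proj_comp_proj φ htu (Nat.le_succ u), ← extMap_comp_apply, hι.map_succ, ih]

lemma exists_eq_of_le (t : ℕ) (h : H) : ∃ u, t ≤ u ∧ ∃ x, ι u x = h := by
  obtain ⟨u, x, rfl⟩ := hι.exists_eq h
  exact ⟨max t u, le_max_left _ _, _, hι.map_proj (le_max_right t u) x⟩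

lemma exists_end (f : ∀ t, ExtMod ω (PhiPow φ t) c →ₗ[DetR 𝕜 m n] ExtMod ω (PhiPow φ t) c)
    (hf : ∀ {t u} (htu : t ≤ u) x,
      f u (extMap ω (proj φ htu) c x) = extMap ω (proj φ htu) c (f t x)) :
    ∃ g : Module.End (DetR 𝕜 m n) H, ∀ t x, g (ι t x) = ι t (f t x) := by
  choose τ ξ hξ using hι.exists_eq
  have key : ∀ t x, ι (τ (ι t x)) (f _ (ξ (ι t x))) = ι t (f t x) := by
    intro t x
    set h := ι t x with hh
    rw [← hι.map_proj (le_max_left (τ h) t) (f _ _), ← hι.map_proj (le_max_right (τ h) t) (f _ _),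
      ← hf, ← hf]
    congr 2
    apply hι.injective
    rw [hι.map_proj, hι.map_proj, hξ]
  refine ⟨⟨⟨fun h => ι (τ h) (f _ (ξ h)), fun h h' => ?_⟩, fun r h => ?_⟩, key⟩
  · obtain ⟨t, x, rfl⟩ := hι.exists_eq h
    obtain ⟨u, htu, y, rfl⟩ := hι.exists_eq_of_le t h'
    rw [← hι.map_proj htu x, ← map_add, key, key, key, map_add, map_add]
  · obtain ⟨t, x, rfl⟩ := hι.exists_eq h
    refine (congrArg (fun y => ι (τ y) (f _ (ξ y))) (map_smul (ι t) r x).symm).trans ?_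
    exact (key t (r • x)).trans (by rw [map_smul, map_smul, ← key]; rfl)

/-- A power series acts on each `Ext(S/(a)^t, ω)` by functoriality, hence on their union. -/
lemma exists_ringHom : ∃ σ : DetS 𝕜 m n →+* Module.End (DetR 𝕜 m n) H,
    ∀ s t x, σ s (ι t x) = ι t (extMap ω (smulMap φ t s) c x) := by
  choose σ hσ using fun s : DetS 𝕜 m n =>
    hι.exists_end (fun t => extMap ω (smulMap φ t s) c) fun htu x => by
      rw [extMap_comp_apply, extMap_comp_apply, smulMap_comp_proj]
  have hone : σ 1 = 1 := by
    ext h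
    obtain ⟨t, x, rfl⟩ := hι.exists_eq h
    rw [hσ, ← map_one φ, smulMap_phi, extMap_smul_id, one_smul]
    rfl
  have hmul : ∀ s s', σ (s * s') = σ s * σ s' := by
    intro s s'
    ext h
    obtain ⟨t, x, rfl⟩ := hι.exists_eq h
    rw [Module.End.mul_apply, hσ, hσ, hσ, smulMap_mul, extMap_comp_apply]
  have hadd : ∀ s s', σ (s + s') = σ s + σ s' := by
    intro s s'
    ext h
    obtain ⟨t, x, rfl⟩ := hι.exists_eq h
    rw [LinearMap.add_apply, hσ, hσ, hσ, smulMap_add, extMap_add, LinearMap.add_apply, map_add]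
  refine ⟨RingHom.mk' ⟨⟨σ, hone⟩, hmul⟩ hadd, hσ⟩

lemma exists_isPowFiltration (hφ : IsDetPhi 𝕜 m n φ) (hn : 1 ≤ n)
    (h : IsExtSelfDual ω (PhiPow φ 1) c) :
    ∃ (_ : Module (DetS 𝕜 m n) H) (W : ℕ → Submodule (DetS 𝕜 m n) H) (e : H),
      IsPowFiltration φ W e := by
  classical
  obtain ⟨σ, hσ⟩ := hι.exists_ringHom
  obtain ⟨E⟩ := h.equiv
  let _ : Module (DetS 𝕜 m n) H := Module.compHom H σ
  have smul_def : ∀ (s : DetS 𝕜 m n) (y : H), s • y = σ s y := fun _ _ => rfl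
  have smul_ι : ∀ (s : DetS 𝕜 m n) t x, s • ι t x = ι t (extMap ω (smulMap φ t s) c x) := hσ
  let W : ℕ → Submodule (DetS 𝕜 m n) H := fun t =>
    { (LinearMap.range (ι t)).toAddSubmonoid with
      smul_mem' := by
        rintro s _ ⟨x, rfl⟩
        exact ⟨_, (smul_ι s t x).symm⟩ }
  have mem_W : ∀ t y, y ∈ W t ↔ ∃ x, ι t x = y := fun _ _ => Iff.rfl
  have phi_smul : ∀ (r : DetR 𝕜 m n) (y : H), φ r • y = r • y := by
    intro r y
    obtain ⟨t, x, rfl⟩ := hι.exists_eq y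
    rw [smul_ι, smulMap_phi, extMap_smul_id, map_smul]
  have mon_smul : ∀ t (α : aExps m n t) x, (monomial (α : _ →₀ ℕ) 1 : DetS 𝕜 m n) • ι (t + 1) x =
      ι 1 (extMap ω (monMap φ α) c x) := by
    intro t α x
    rw [smul_ι, ← monMap_comp_proj, ← extMap_comp_apply, hι.map_proj]
  have hgen : ∀ x : PhiPow φ 1, ∃ r : DetR 𝕜 m n, r • PhiQuot.mk φ 1 = x := by
    intro x
    rw [← Submodule.mem_span_singleton, span_mk_one_eq_top φ hφ hn subset_rfl]
    trivial
  refine ⟨‹_›, W, ι 1 (E.symm (PhiQuot.mk φ 1)), phi_smul, ?_, ?_, ?_, ?_, ?_, ?_, ?_, ?_, ?_⟩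
  · rintro _ ⟨x, rfl⟩
    have := subsingleton_extMod_of_subsingleton (M := PhiPow φ 0) ω c
    rw [Subsingleton.elim x 0, map_zero]
  · rintro t u htu _ ⟨x, rfl⟩
    exact ⟨_, hι.map_proj htu x⟩
  · exact hι.exists_eq
  · rintro t s hs _ ⟨x, rfl⟩
    rw [smul_ι, smulMap_eq_zero hs, extMap_zero, LinearMap.zero_apply, map_zero]
  · rintro t _ ⟨x, rfl⟩ hx
    obtain ⟨y, rfl⟩ := mem_range_extMap_proj φ ω t x fun α => hι.injective 1 (by
      rw [← mon_smul, hx _ α.2, map_zero])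
    exact ⟨y, (hι.map_succ t y).symm⟩
  · intro t α hα
    obtain ⟨x, hx⟩ := exists_extMap_monMap_eq φ ω h t
      fun β => if (β : _ →₀ ℕ) = α then E.symm (PhiQuot.mk φ 1) else 0
    refine ⟨_, ⟨x, rfl⟩, fun β hβ => ?_⟩
    rw [mon_smul t ⟨β, hβ⟩, hx, apply_ite (ι 1), map_zero]
  · exact ⟨_, rfl⟩
  · rintro _ ⟨x, rfl⟩
    obtain ⟨r, hr⟩ := hgen (E x)
    refine ⟨φ r, ?_⟩
    rw [phi_smul, ← map_smul, ← map_smul, hr, E.symm_apply_apply]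
  · intro s hs
    obtain ⟨r, hr⟩ := hgen (PhiQuot.mk φ s)
    rw [PhiQuot.smul_eq, PhiQuot.smul_mk, mul_one, PhiQuot.mk_eq_mk] at hr
    have h0 := smulMap_eq_zero (φ := φ) hr
    have h1 : φ r • ι 1 (E.symm (PhiQuot.mk φ 1)) = 0 := by
      rw [← hs, ← sub_eq_zero, ← sub_smul, smul_ι, h0, extMap_zero, LinearMap.zero_apply, map_zero]
    rw [phi_smul, ← map_smul, ← map_smul, map_eq_zero_iff _ (hι.injective 1),
      EmbeddingLike.map_eq_zero_iff, PhiQuot.smul_eq, PhiQuot.smul_mk, mul_one,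
      PhiQuot.mk_eq_zero] at h1
    have := sub_mem h1 hr
    rwa [sub_sub_cancel] at this

end IsExtUnion

end ExtUnion

section EndEquiv

variable {𝕜 : Type} [Field 𝕜] {m n : ℕ} {φ : DetR 𝕜 m n →ₐ[𝕜] DetS 𝕜 m n}
  {H : Type} [AddCommGroup H] [Module (DetR 𝕜 m n) H] [Module (DetS 𝕜 m n) H]

lemma IsPowFiltration.exists_ringEquiv {W : ℕ → Submodule (DetS 𝕜 m n) H} {e : H}
    (hW : IsPowFiltration φ W e) (hφ : IsDetPhi 𝕜 m n φ) (hm : 1 ≤ m) (hn : 1 ≤ n) :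
    ∃ E : Module.End (DetR 𝕜 m n) H ≃+* DetS 𝕜 m n,
      ∀ r, E (algebraMap (DetR 𝕜 m n) (Module.End (DetR 𝕜 m n) H) r) = φ r := by
  let L : DetS 𝕜 m n → Module.End (DetR 𝕜 m n) H := fun s =>
    { toFun := fun h => s • h
      map_add' := smul_add s
      map_smul' := fun r h => by
        rw [← hW.phi_smul, ← hW.phi_smul, RingHom.id_apply, smul_comm] }
  let F : DetS 𝕜 m n →+* Module.End (DetR 𝕜 m n) H :=
    { toFun := L
      map_one' := LinearMap.ext fun h => one_smul _ h
      map_mul' := fun s s' => LinearMap.ext fun h => mul_smul s s' h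
      map_zero' := LinearMap.ext fun h => zero_smul _ h
      map_add' := fun s s' => LinearMap.ext fun h => add_smul s s' h }
  have hF : ∀ s h, F s h = s • h := fun _ _ => rfl
  have hbij : Function.Bijective F := by
    constructor
    · rw [injective_iff_map_eq_zero]
      intro s hs
      exact hW.eq_zero_of_forall_smul_eq_zero fun h => by rw [← hF, hs, LinearMap.zero_apply]
    · intro f
      obtain ⟨s, hs⟩ := hW.exists_forall_smul_eq hφ hm hn f
      exact ⟨s, LinearMap.ext fun h => (hs h).symm⟩
  refine ⟨(RingEquiv.ofBijective F hbij).symm, fun r => ?_⟩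
  rw [RingEquiv.symm_apply_eq]
  exact LinearMap.ext fun h => (hW.phi_smul r h).symm

end EndEquiv

section QuotientPowers

variable {𝕜 : Type} [Field 𝕜] {m n : ℕ} (φ : DetR 𝕜 m n →ₐ[𝕜] DetS 𝕜 m n)
  (hφ : IsDetPhi 𝕜 m n φ)

include hφ

/-- The map `R/I^t → S/(a_1, …, a_{n-1})^t` induced by `φ`. -/
def quotPowMap [IsLocalRing (DetR 𝕜 m n)] (t : ℕ) :
    (DetR 𝕜 m n ⧸ detJ 𝕜 m n ^ t) →ₗ[DetR 𝕜 m n] PhiPow φ t :=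
  (detJ 𝕜 m n ^ t).liftQ (LinearMap.toSpanSingleton (DetR 𝕜 m n) (PhiPow φ t) (PhiQuot.mk φ 1))
    fun r hr => by
      rw [LinearMap.mem_ker, LinearMap.toSpanSingleton_apply, PhiQuot.smul_eq, PhiQuot.smul_mk,
        mul_one, PhiQuot.mk_eq_zero]
      exact (mem_detJ_pow_iff φ hφ).1 hr

variable [IsLocalRing (DetR 𝕜 m n)]

lemma quotPowMap_mk (t : ℕ) (r : DetR 𝕜 m n) :
    quotPowMap φ hφ t (Submodule.Quotient.mk r) = PhiQuot.mk φ (φ r) := by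
  refine ((detJ 𝕜 m n ^ t).liftQ_apply _ r).trans ?_
  rw [LinearMap.toSpanSingleton_apply, PhiQuot.smul_eq, PhiQuot.smul_mk, mul_one]

lemma quotPowMap_injective (t : ℕ) : Function.Injective (quotPowMap φ hφ t) := by
  rw [injective_iff_map_eq_zero]
  intro y hy
  obtain ⟨r, rfl⟩ := Submodule.Quotient.mk_surjective _ y
  rw [quotPowMap_mk, PhiQuot.mk_eq_zero, ← mem_detJ_pow_iff φ hφ] at hy
  exact (Submodule.Quotient.mk_eq_zero _).2 hy

lemma quotPowMap_comp_mapQ {t u : ℕ} (htu : t ≤ u) :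
    quotPowMap φ hφ t ∘ₗ Submodule.mapQ (detJ 𝕜 m n ^ u) (detJ 𝕜 m n ^ t) LinearMap.id
      (Ideal.pow_le_pow_right htu) = PhiPow.proj φ htu ∘ₗ quotPowMap φ hφ u := by
  refine LinearMap.ext fun y => ?_
  obtain ⟨r, rfl⟩ := Submodule.Quotient.mk_surjective _ y
  rw [LinearMap.comp_apply, LinearMap.comp_apply, Submodule.mapQ_apply, LinearMap.id_apply,
    quotPowMap_mk, quotPowMap_mk, PhiPow.proj_mk]

lemma smul_mem_range_quotPowMap (hn : 1 ≤ n) (t : ℕ) {r : DetR 𝕜 m n}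
    (hr : r ∈ IsLocalRing.maximalIdeal (DetR 𝕜 m n) ^ t) (y : PhiPow φ t) :
    r • y ∈ LinearMap.range (quotPowMap φ hφ t) := by
  classical
  obtain ⟨s, rfl⟩ := PhiQuot.mk_surjective φ y
  have hs : φ r * s ∈ wtIdeal (xdeg m n) t :=
    Ideal.mul_mem_right _ _ (phi_mem_of_mem_maximalIdeal_pow φ hφ hr)
  let s₀ : DetS 𝕜 m n := fun d => if adeg m n d < t then coeff d (φ r * s) else 0
  have hs₀ : ∀ d, coeff d s₀ = if adeg m n d < t then coeff d (φ r * s) else 0 := fun _ => rfl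
  obtain ⟨r', hr'⟩ := exists_phi_eq φ hφ hn s₀ fun d hd => by
    rw [hs₀] at hd
    split_ifs at hd with h
    · by_contra hlt
      exact hd (hs d (by omega))
    · exact absurd rfl hd
  refine ⟨Submodule.Quotient.mk r', ?_⟩
  rw [quotPowMap_mk, hr', PhiQuot.smul_eq, PhiQuot.smul_mk, PhiQuot.mk_eq_mk]
  intro d hd
  rw [map_sub, hs₀, if_pos hd, sub_self]

lemma extMap_quotPowMap_bijective [IsNoetherianRing (DetR 𝕜 m n)] (hn : 1 ≤ n)
    (ω : ModuleCat.{0} (DetR 𝕜 m n)) [Module.Finite (DetR 𝕜 m n) ω] {d : ℕ}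
    (h : IsExtSelfDual ω (IsLocalRing.ResidueField (DetR 𝕜 m n)) d) (t c : ℕ) (hc : c + 1 < d) :
    Function.Bijective (extMap ω (quotPowMap φ hφ t) c) := by
  have := PhiPow.finite φ hφ hn t
  set f := quotPowMap φ hφ t
  have hK : ∀ i, i ≠ d → Subsingleton (ExtMod ω (PhiPow φ t ⧸ LinearMap.range f) i) := fun i hi =>
    subsingleton_extMod_of_maximalIdeal_pow_smul ω d i hi h t fun r hr y => by
      obtain ⟨y, rfl⟩ := Submodule.Quotient.mk_surjective _ y
      rw [← Submodule.Quotient.mk_smul, Submodule.Quotient.mk_eq_zero]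
      exact smul_mem_range_quotPowMap φ hφ hn t hr y
  have hf := quotPowMap_injective φ hφ t
  have hex : Function.Exact f (LinearMap.range f).mkQ := f.exact_map_mkQ_range
  have hsurj := (LinearMap.range f).mkQ_surjective
  refine ⟨?_, extMap_surjective_of_subsingleton ω hf hex hsurj c (hK _ (by omega))⟩
  rw [injective_iff_map_eq_zero]
  intro x hx
  obtain ⟨z, rfl⟩ := (extMap_exact ω hf hex hsurj c x).1 hx
  have := hK c (by omega)
  rw [Subsingleton.elim z 0, map_zero]

end QuotientPowers

section LocalCohomologyColimit

variable {R : Type} [CommRing R] (J : Ideal R) (ω : ModuleCat.{0} R)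

/-- The canonical map `Ext(R/J^t, ω) → H_J(ω)`. -/
def localCohomologyOfExt (p c : ℕ) (hp : p + 1 = c) (t : ℕ) :
    ExtMod ω (R ⧸ J ^ t) c →ₗ[R] (localCohomology J c).obj ω :=
  ((Limits.colimit.ι (localCohomology.diagram (localCohomology.idealPowersDiagram J) c)
    (op (op t))).app ω).hom ∘ₗ
      (extEquivAbelianExt (ModuleCat.of R (R ⧸ J ^ t)) ω p c hp).symm.toLinearMap

variable {p c : ℕ} (hp : p + 1 = c)

lemma localCohomologyOfExt_extEquivAbelianExt (t : ℕ)
    (x : ((_root_.Ext R (ModuleCat.{0} R) c).obj (op (ModuleCat.of R (R ⧸ J ^ t)))).obj ω) :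
    localCohomologyOfExt J ω p c hp t (extEquivAbelianExt _ ω p c hp x) =
      ((Limits.colimit.ι (localCohomology.diagram (localCohomology.idealPowersDiagram J) c)
        (op (op t))).app ω).hom x :=
  congrArg _ (LinearEquiv.symm_apply_apply _ x)

lemma extEquivAbelianExt_diagram_map {t u : ℕ} (htu : t ≤ u)
    (x : ((_root_.Ext R (ModuleCat.{0} R) c).obj (op (ModuleCat.of R (R ⧸ J ^ t)))).obj ω) :
    extEquivAbelianExt (ModuleCat.of R (R ⧸ J ^ u)) ω p c hp
      ((((localCohomology.diagram (localCohomology.idealPowersDiagram J) c).map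
        (homOfLE htu).op.op).app ω).hom x) =
      extMap ω (Submodule.mapQ (J ^ u) (J ^ t) LinearMap.id (Ideal.pow_le_pow_right htu)) c
        (extEquivAbelianExt _ ω p c hp x) :=
  extEquivAbelianExt_naturality _ ω p c hp x

lemma localCohomologyOfExt_extMap {t u : ℕ} (htu : t ≤ u) (x : ExtMod ω (R ⧸ J ^ t) c) :
    localCohomologyOfExt J ω p c hp u
      (extMap ω (Submodule.mapQ (J ^ u) (J ^ t) LinearMap.id (Ideal.pow_le_pow_right htu)) c x) =
      localCohomologyOfExt J ω p c hp t x := by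
  obtain ⟨y, rfl⟩ := (extEquivAbelianExt _ ω p c hp).surjective x
  refine ((congrArg _ (extEquivAbelianExt_diagram_map J ω hp htu y).symm).trans
    (localCohomologyOfExt_extEquivAbelianExt J ω hp u _)).trans
      (.trans ?_ (localCohomologyOfExt_extEquivAbelianExt J ω hp t y).symm)
  exact congrArg (fun f => (f.app ω).hom y) (Limits.colimit.w
    (localCohomology.diagram (localCohomology.idealPowersDiagram J) c) (homOfLE htu).op.op)

/-- Local cohomology of `ω`, as the colimit of the modules `Ext(R/J^t, ω)`. -/
def localCohomologyIsColimit (c : ℕ) :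
    Limits.IsColimit (((evaluation (ModuleCat.{0} R) (ModuleCat.{0} R)).obj ω).mapCocone
      (Limits.colimit.cocone (localCohomology.diagram (localCohomology.idealPowersDiagram J) c))) :=
  Limits.isColimitOfPreserves _ (Limits.colimit.isColimit _)

lemma exists_localCohomologyOfExt_eq (h : (localCohomology J c).obj ω) :
    ∃ t x, localCohomologyOfExt J ω p c hp t x = h := by
  obtain ⟨j, x, hx⟩ := Limits.Concrete.isColimit_exists_rep _ (localCohomologyIsColimit J ω c) h
  exact ⟨j.unop.unop, _, (localCohomologyOfExt_extEquivAbelianExt J ω hp _ x).trans hx⟩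

lemma exists_extMap_eq_zero {t : ℕ} {x : ExtMod ω (R ⧸ J ^ t) c}
    (hx : localCohomologyOfExt J ω p c hp t x = 0) : ∃ (u : ℕ) (htu : t ≤ u),
      extMap ω (Submodule.mapQ (J ^ u) (J ^ t) LinearMap.id (Ideal.pow_le_pow_right htu)) c x
        = 0 := by
  obtain ⟨y, rfl⟩ := (extEquivAbelianExt _ ω p c hp).surjective x
  rw [localCohomologyOfExt_extEquivAbelianExt] at hx
  obtain ⟨k, f, g, hfg⟩ := Limits.Concrete.isColimit_exists_of_rep_eq _
    (localCohomologyIsColimit J ω c) (i := op (op t)) (j := op (op t)) y 0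
    (hx.trans (map_zero _).symm)
  refine ⟨k.unop.unop, leOfHom f.unop.unop, ?_⟩
  refine (extEquivAbelianExt_diagram_map J ω hp (leOfHom f.unop.unop) y).symm.trans ?_
  exact (congrArg _ (hfg.trans (map_zero _))).trans (map_zero _)

end LocalCohomologyColimit

section Assembly

lemma IsCanonicalModule.isExtSelfDual {R : Type} [CommRing R] [IsLocalRing R] {d : ℕ}
    {ω : ModuleCat.{0} R} (h : IsCanonicalModule R d ω) (hd : d ≠ 0) :
    IsExtSelfDual ω (IsLocalRing.ResidueField R) d := by
  obtain ⟨p, rfl⟩ := Nat.exists_eq_succ_of_ne_zero hd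
  obtain ⟨-, h1, ⟨E⟩⟩ := h
  exact ⟨fun i hi => subsingleton_abelianExt _ ω i (h1 i hi),
    ⟨(extEquivAbelianExt _ ω p _ rfl).symm ≪≫ₗ E⟩⟩

variable {𝕜 : Type} [Field 𝕜] {m n : ℕ} [IsLocalRing (DetR 𝕜 m n)]
  {φ : DetR 𝕜 m n →ₐ[𝕜] DetS 𝕜 m n} {ω : ModuleCat.{0} (DetR 𝕜 m n)}

lemma isExtUnion_localCohomology (hφ : IsDetPhi 𝕜 m n φ) {p c : ℕ} (hp : p + 1 = c)
    (hinj : ∀ {t u : ℕ} (htu : t ≤ u), Function.Injective (extMap ω (PhiPow.proj φ htu) c))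
    (hbij : ∀ t, Function.Bijective (extMap ω (quotPowMap φ hφ t) c)) :
    IsExtUnion φ ω c fun t =>
      localCohomologyOfExt (detJ 𝕜 m n) ω p c hp t ∘ₗ extMap ω (quotPowMap φ hφ t) c where
  map_succ t x := by
    rw [LinearMap.comp_apply, LinearMap.comp_apply, extMap_comp_apply,
      ← quotPowMap_comp_mapQ φ hφ (Nat.le_succ t), ← extMap_comp_apply,
      localCohomologyOfExt_extMap _ ω hp (Nat.le_succ t)]
  injective t := by
    rw [injective_iff_map_eq_zero]
    intro x hx
    obtain ⟨u, htu, hu⟩ := exists_extMap_eq_zero _ ω hp hx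
    rw [extMap_comp_apply, quotPowMap_comp_mapQ φ hφ htu, ← extMap_comp_apply,
      map_eq_zero_iff _ (hbij u).1, map_eq_zero_iff _ (hinj htu)] at hu
    exact hu
  exists_eq h := by
    obtain ⟨t, x, rfl⟩ := exists_localCohomologyOfExt_eq _ ω hp h
    obtain ⟨y, rfl⟩ := (hbij t).2 x
    exact ⟨t, y, rfl⟩

end Assembly

/-- for any canonical module `ω_R` of `R`, the endomorphism ring
`Hom_R(H^{n-1}_I(ω_R), H^{n-1}_I(ω_R))` is isomorphic as an `R`-algebra to the power
series ring `S` (an `R`-algebra via `φ`); in particular it is commutative and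
Noetherian. -/
theorem statement11 [IsLocalRing (DetR 𝕜 m n)] (hm : 2 ≤ m) (hn : 2 ≤ n)
    (ω : ModuleCat (DetR 𝕜 m n)) (hω : IsCanonicalModule (DetR 𝕜 m n) (m + n - 1) ω)
    (φ : DetR 𝕜 m n →ₐ[𝕜] DetS 𝕜 m n) (hφ : IsDetPhi 𝕜 m n φ) :
    haveI : Algebra (DetR 𝕜 m n) (DetS 𝕜 m n) := φ.toRingHom.toAlgebra
    Nonempty
      ((Module.End (DetR 𝕜 m n) ((localCohomology (detJ 𝕜 m n) (n - 1)).obj ω))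
        ≃ₐ[DetR 𝕜 m n] DetS 𝕜 m n) ∧
    (∀ f g : Module.End (DetR 𝕜 m n) ((localCohomology (detJ 𝕜 m n) (n - 1)).obj ω),
      f * g = g * f) ∧
    IsNoetherianRing
      (Module.End (DetR 𝕜 m n) ((localCohomology (detJ 𝕜 m n) (n - 1)).obj ω)) := by
  have hfin : Module.Finite (DetR 𝕜 m n) ω := hω.1
  have hnoeth : IsNoetherianRing (DetS 𝕜 m n) := inferInstance
  have hself := hω.isExtSelfDual (by omega)
  have hone := isExtSelfDual_phiQuot_aVars φ hφ (by omega) ω hself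
  have hι := isExtUnion_localCohomology hφ (show n - 2 + 1 = n - 1 by omega)
    (PhiPow.extMap_proj_injective φ ω hone)
    fun t => extMap_quotPowMap_bijective φ hφ (by omega) ω hself t (n - 1) (by omega)
  obtain ⟨_, W, e, hW⟩ := hι.exists_isPowFiltration hφ (by omega) hone
  obtain ⟨E, hE⟩ := hW.exists_ringEquiv hφ (by omega) (by omega)
  let _ : Algebra (DetR 𝕜 m n) (DetS 𝕜 m n) := φ.toRingHom.toAlgebra
  exact ⟨⟨AlgEquiv.ofRingEquiv (f := E) hE⟩,
    fun f g => E.injective (by rw [map_mul, map_mul, mul_comm]),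
    isNoetherianRing_of_ringEquiv _ E.symm⟩
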